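/- Let H be an infinite-dimensional complex Hilbert space and let F be a regular map sending k-tuples of positive definite invertible bounded operators on H to self-adjoint bounded operators on H. Assume F is convex and positively homogeneous, i.e. F(tA₁,…,tAₖ) = t F(A₁,…,Aₖ) for all t > 0. Then for every invertible bounded operator C on H and every k-tuple (A₁,…,Aₖ) of positive definite invertible operators, F(C*A₁C, …, C*AₖC) = C* F(A₁,…,Aₖ) C. -/

import Mathlib

set_option synthInstance.maxHeartbeats 400000
set_option maxHeartbeats 1000000

noncomputable section

variable {H : Type*} [NormedAddCommGroup H] [InnerProductSpace ℂ H] [CompleteSpace H]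

/-- `a` is a positive definite invertible bounded operator. -/
def IsPosDefInv (a : H →L[ℂ] H) : Prop := 0 ≤ a ∧ IsUnit a

/-- `a` belongs to the compressed domain `D_p`: viewed as an operator on the range of the
projection `p`, it is positive definite and invertible, i.e. `a = p a p ≥ 0` and `a` is
invertible in the corner algebra `p B(H) p`. -/
def IsCornerPosDef (p a : H →L[ℂ] H) : Prop :=
  0 ≤ a ∧ p * a * p = a ∧ ∃ b : H →L[ℂ] H, p * b * p = b ∧ a * b = p ∧ b * a = p

/-- A regular operator mapping of `k`-tuples of positive definite invertible bounded operators: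
it is unitarily invariant and compatible with block diagonal decompositions with respect to
any pair of mutually orthogonal (self-adjoint idempotent) projections, the compressed tuples
lying in the compressed domains. -/
def IsRegularPD {k : ℕ} (F : (Fin k → (H →L[ℂ] H)) → (H →L[ℂ] H)) : Prop :=
  (∀ u ∈ unitary (H →L[ℂ] H), ∀ A : Fin k → (H →L[ℂ] H), (∀ i, IsPosDefInv (A i)) →
      F (fun i => star u * A i * u) = star u * F A * u) ∧
  (∀ p q : H →L[ℂ] H, IsSelfAdjoint p → IsIdempotentElem p →
      IsSelfAdjoint q → IsIdempotentElem q → p * q = 0 →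
      ∀ x y : Fin k → (H →L[ℂ] H),
        (∀ i, IsCornerPosDef p (p * x i * p)) → (∀ i, IsCornerPosDef q (q * y i * q)) →
        F (fun i => p * x i * p + q * y i * q) =
          p * F (fun i => p * x i * p) * p + q * F (fun i => q * y i * q) * q)

set_option linter.unusedSectionVars false
set_option linter.unusedSimpArgs false

section CStarAlgebra

variable {𝔸 : Type*} [CStarAlgebra 𝔸] [PartialOrder 𝔸] [StarOrderedRing 𝔸] {k : ℕ}

/-- Rewriting `a * b = c` inside a right-associated product. -/
theorem mul_mul_of_mul_eq {M : Type*} [Semigroup M] {a b c : M} (h : a * b = c) (x : M) :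
    a * (b * x) = c * x := by
  rw [← mul_assoc, h]

theorem isStrictlyPositive_iff_exists_smul_one_le {a : 𝔸} :
    IsStrictlyPositive a ↔ ∃ r : ℝ, 0 < r ∧ r • (1 : 𝔸) ≤ a := by
  constructor
  · intro h
    rcases subsingleton_or_nontrivial 𝔸 with _ | _
    · exact ⟨1, one_pos, (Subsingleton.elim _ _).le⟩
    obtain ⟨r, hr, hra⟩ := (CFC.exists_pos_algebraMap_le_iff h.isSelfAdjoint).2
      fun x hx => h.spectrum_pos hx
    exact ⟨r, hr, by rwa [← Algebra.algebraMap_eq_smul_one]⟩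
  · rintro ⟨r, hr, hra⟩
    exact (isStrictlyPositive_one.smul hr).of_le hra

theorem IsSelfAdjoint.le_norm_smul_one {a : 𝔸} (h : IsSelfAdjoint a) : a ≤ ‖a‖ • (1 : 𝔸) := by
  rw [← Algebra.algebraMap_eq_smul_one]
  exact h.le_algebraMap_norm_self

theorem IsSelfAdjoint.neg_norm_smul_one_le {a : 𝔸} (h : IsSelfAdjoint a) :
    -(‖a‖ • (1 : 𝔸)) ≤ a := by
  rw [← Algebra.algebraMap_eq_smul_one]
  exact h.neg_algebraMap_norm_le_self

theorem smul_one_le_smul_one {r s : ℝ} (h : r ≤ s) : r • (1 : 𝔸) ≤ s • (1 : 𝔸) :=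
  smul_le_smul_of_nonneg_right h zero_le_one

theorem le_of_forall_pos_le_add_smul_one {a b : 𝔸}
    (h : ∀ ε : ℝ, 0 < ε → a ≤ b + ε • (1 : 𝔸)) : a ≤ b := by
  have hlim : Filter.Tendsto (fun ε : ℝ => b + ε • (1 : 𝔸)) (nhdsWithin 0 (Set.Ioi 0))
      (nhds b) := by
    have : Continuous fun ε : ℝ => b + ε • (1 : 𝔸) := by fun_prop
    simpa using (this.tendsto 0).mono_left nhdsWithin_le_nhds
  exact ge_of_tendsto hlim (Filter.eventually_of_mem self_mem_nhdsWithin fun ε hε => h ε hε)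

/-- `a` is positive and invertible in the corner algebra of the projection `p`. -/
def IsStrictlyPositiveIn (p a : 𝔸) : Prop :=
  0 ≤ a ∧ p * a * p = a ∧ ∃ b : 𝔸, p * b * p = b ∧ a * b = p ∧ b * a = p

/-- The tuple `s xᵢ s*`. -/
def conjTuple (s : 𝔸) (x : Fin k → 𝔸) : Fin k → 𝔸 := fun i => s * x i * star s

@[simp]
theorem conjTuple_apply (s : 𝔸) (x : Fin k → 𝔸) (i : Fin k) :
    conjTuple s x i = s * x i * star s := rfl

theorem conjTuple_conjTuple (s t : 𝔸) (x : Fin k → 𝔸) :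
    conjTuple s (conjTuple t x) = conjTuple (s * t) x := by
  ext i; simp [mul_assoc]

theorem conjTuple_add (s : 𝔸) (x y : Fin k → 𝔸) :
    conjTuple s (x + y) = conjTuple s x + conjTuple s y := by
  ext i; simp [mul_add, add_mul]

theorem conjTuple_smul (s : 𝔸) (r : ℝ) (x : Fin k → 𝔸) :
    conjTuple s (r • x) = r • conjTuple s x := by
  ext i; simp

/-- A positively homogeneous, subadditive map on tuples of strictly positive elements. -/
structure IsSublinear (F : (Fin k → 𝔸) → 𝔸) : Prop where
  isSelfAdjoint : ∀ A : Fin k → 𝔸, (∀ i, IsStrictlyPositive (A i)) → IsSelfAdjoint (F A)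
  add_le : ∀ A B : Fin k → 𝔸, (∀ i, IsStrictlyPositive (A i)) →
    (∀ i, IsStrictlyPositive (B i)) → F (A + B) ≤ F A + F B
  smul : ∀ t : ℝ, 0 < t → ∀ A : Fin k → 𝔸, (∀ i, IsStrictlyPositive (A i)) →
    F (t • A) = t • F A

/-- A sublinear map which is unitarily invariant and compatible with block diagonal
decompositions. -/
structure IsRegularSublinear (F : (Fin k → 𝔸) → 𝔸) : Prop extends IsSublinear F where
  unitary_conj : ∀ u ∈ unitary 𝔸, ∀ A : Fin k → 𝔸, (∀ i, IsStrictlyPositive (A i)) →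
    F (conjTuple u A) = u * F A * star u
  corner_add : ∀ p q : 𝔸, IsStarProjection p → IsStarProjection q → p * q = 0 →
    ∀ x y : Fin k → 𝔸, (∀ i, IsStrictlyPositiveIn p (x i)) →
      (∀ i, IsStrictlyPositiveIn q (y i)) →
      F (x + y) = p * F x * p + q * F y * q

theorem isStrictlyPositiveIn_zero : IsStrictlyPositiveIn (0 : 𝔸) 0 :=
  ⟨le_rfl, by simp, 0, by simp⟩

theorem IsStarProjection.isStrictlyPositiveIn {p : 𝔸} (hp : IsStarProjection p) :
    IsStrictlyPositiveIn p p := by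
  have := hp.isIdempotentElem.eq
  exact ⟨hp.nonneg, by simp [this], p, by simp [this], this, this⟩

theorem isStrictlyPositiveIn_one {a : 𝔸} (ha : IsStrictlyPositive a) :
    IsStrictlyPositiveIn 1 a := by
  obtain ⟨u, rfl⟩ := ha.isUnit
  exact ⟨ha.nonneg, by simp, ↑u⁻¹, by simp⟩

theorem IsStrictlyPositiveIn.isStrictlyPositive {a : 𝔸} (ha : IsStrictlyPositiveIn 1 a) :
    IsStrictlyPositive a := by
  obtain ⟨h0, -, b, -, h1, h2⟩ := ha
  exact ⟨h0, ⟨⟨a, b, h1, h2⟩, rfl⟩⟩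

theorem isStarProjection_mul_star {s p : 𝔸} (hsp : s * p = s) (hs : star s * s = p) :
    IsStarProjection (s * star s) := by
  refine ⟨?_, by simp [IsSelfAdjoint]⟩
  rw [IsIdempotentElem]
  calc s * star s * (s * star s) = s * (star s * s) * star s := by simp only [mul_assoc]
    _ = s * star s := by rw [hs, hsp]

theorem IsStrictlyPositiveIn.conj {s p x : 𝔸} (hx : IsStrictlyPositiveIn p x) (hsp : s * p = s)
    (hs : star s * s = p) : IsStrictlyPositiveIn (s * star s) (s * x * star s) := by
  obtain ⟨h0, hpx, b, hb, h1, h2⟩ := hx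
  have hps : p * star s = star s := by
    have := congrArg star hsp
    rwa [star_mul, ← hs, star_mul, star_star, hs] at this
  have hpx' : p * (x * p) = x := by rw [← mul_assoc, hpx]
  refine ⟨star_right_conjugate_nonneg h0 s, ?_, s * b * star s, ?_, ?_, ?_⟩
  · calc _ = s * (star s * s * x * (star s * s)) * star s := by simp only [mul_assoc]
      _ = _ := by rw [hs, hpx]
  · calc _ = s * (star s * s * b * (star s * s)) * star s := by simp only [mul_assoc]
      _ = _ := by rw [hs, hb]
  · calc _ = s * x * (star s * s) * b * star s := by simp only [mul_assoc]
      _ = s * x * (p * b * p) * star s := by rw [hs]; simp only [mul_assoc, hps]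
      _ = s * (x * b) * star s := by rw [hb]; simp only [mul_assoc]
      _ = _ := by rw [h1, hsp]
  · calc _ = s * b * (star s * s) * x * star s := by simp only [mul_assoc]
      _ = s * b * (p * x * p) * star s := by rw [hs]; simp only [mul_assoc, hps]
      _ = s * (b * x) * star s := by rw [hpx]; simp only [mul_assoc]
      _ = _ := by rw [h2, hsp]

theorem IsStarProjection.mul_eq_zero_symm {p q : 𝔸} (hp : IsStarProjection p)
    (hq : IsStarProjection q) (hpq : p * q = 0) : q * p = 0 := by
  have := congrArg star hpq
  rwa [star_mul, hp.isSelfAdjoint.star_eq, hq.isSelfAdjoint.star_eq, star_zero] at this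

theorem IsStrictlyPositiveIn.left {p x : 𝔸} (hx : IsStrictlyPositiveIn p x)
    (hp : IsStarProjection p) : p * x = x := by
  have hpp := hp.isIdempotentElem.eq
  conv_rhs => rw [← hx.2.1]
  rw [← hx.2.1]; simp only [mul_assoc, mul_mul_of_mul_eq hpp, hpp]

theorem IsStrictlyPositiveIn.right {p x : 𝔸} (hx : IsStrictlyPositiveIn p x)
    (hp : IsStarProjection p) : x * p = x := by
  have hpp := hp.isIdempotentElem.eq
  conv_rhs => rw [← hx.2.1]
  rw [← hx.2.1]; simp only [mul_assoc, mul_mul_of_mul_eq hpp, hpp]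

theorem IsStrictlyPositiveIn.add {p q x y : 𝔸} (hx : IsStrictlyPositiveIn p x)
    (hy : IsStrictlyPositiveIn q y) (hp : IsStarProjection p) (hq : IsStarProjection q)
    (hpq : p * q = 0) : IsStrictlyPositiveIn (p + q) (x + y) := by
  have hqp := hp.mul_eq_zero_symm hq hpq
  have px := hx.left hp
  have xp := hx.right hp
  have qy := hy.left hq
  have yq := hy.right hq
  obtain ⟨hx0, hpx, b, hb, hxb, hbx⟩ := hx
  obtain ⟨hy0, hqy, c, hc, hyc, hcy⟩ := hy
  have hpp := hp.isIdempotentElem.eq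
  have hqq := hq.isIdempotentElem.eq
  have pb : p * b = b := by rw [← hb]; simp only [mul_assoc, mul_mul_of_mul_eq hpp, hpp]
  have bp : b * p = b := by rw [← hb]; simp only [mul_assoc, mul_mul_of_mul_eq hpp, hpp]
  have qc : q * c = c := by rw [← hc]; simp only [mul_assoc, mul_mul_of_mul_eq hqq, hqq]
  have cq : c * q = c := by rw [← hc]; simp only [mul_assoc, mul_mul_of_mul_eq hqq, hqq]
  have key : ∀ a d : 𝔸, a * p = a → q * d = d → a * d = 0 := fun a d h1 h2 => by
    rw [← h1, ← h2, mul_assoc, mul_mul_of_mul_eq hpq, zero_mul, mul_zero]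
  have key' : ∀ a d : 𝔸, a * q = a → p * d = d → a * d = 0 := fun a d h1 h2 => by
    rw [← h1, ← h2, mul_assoc, mul_mul_of_mul_eq hqp, zero_mul, mul_zero]
  refine ⟨add_nonneg hx0 hy0, ?_, b + c, ?_, ?_, ?_⟩
  · simp only [mul_add, add_mul, px, xp, qy, yq, key p y hpp qy, key' q x hqq px, key x q xp hqq,
      key' y p yq hpp, add_zero, zero_add]
  · simp only [mul_add, add_mul, pb, bp, qc, cq, key p c hpp qc, key' q b hqq pb, key b q bp hqq,
      key' c p cq hpp, add_zero, zero_add, zero_mul]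
  · simp only [mul_add, add_mul, hxb, hyc, key x c xp qc, key' y b yq pb, add_zero, zero_add]
  · simp only [mul_add, add_mul, hbx, hcy, key b y bp qy, key' c x cq px, add_zero, zero_add]

theorem IsStrictlyPositive.compress {p x : 𝔸} (hx : IsStrictlyPositive x)
    (hp : IsStarProjection p) : IsStrictlyPositiveIn p (p * x * p) := by
  have hpp := hp.isIdempotentElem.eq
  have hps := hp.isSelfAdjoint.star_eq
  obtain ⟨r, hr, hrx⟩ := isStrictlyPositive_iff_exists_smul_one_le.1 hx
  have hnn : 0 ≤ p * x * p := by simpa [hps] using star_left_conjugate_nonneg hx.nonneg p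
  have hpos : IsStrictlyPositive (p * x * p + (1 - p)) := by
    refine isStrictlyPositive_iff_exists_smul_one_le.2 ⟨min r 1, by positivity, ?_⟩
    have h1 : r • p ≤ p * x * p := by
      have := star_left_conjugate_le_conjugate hrx p
      simpa [hps, hpp] using this
    have h2 : min r 1 • p ≤ r • p := smul_le_smul_of_nonneg_right (min_le_left _ _) hp.nonneg
    have h3 : min r 1 • (1 - p) ≤ (1 : ℝ) • (1 - p) :=
      smul_le_smul_of_nonneg_right (min_le_right _ _) hp.one_sub.nonneg
    calc min r 1 • (1 : 𝔸) = min r 1 • p + min r 1 • (1 - p) := by module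
      _ ≤ p * x * p + (1 : ℝ) • (1 - p) := add_le_add (h2.trans h1) h3
      _ = _ := by rw [one_smul]
  obtain ⟨u, hu⟩ := hpos.isUnit
  have e1 : p * ↑u = p * x * p := by
    rw [hu]; simp [mul_add, mul_sub, mul_assoc, hpp, mul_mul_of_mul_eq hpp]
  have e2 : ↑u * p = p * x * p := by
    rw [hu]; simp [add_mul, sub_mul, mul_assoc, hpp, mul_mul_of_mul_eq hpp]
  have e3 : p * ↑u⁻¹ = ↑u⁻¹ * p := by
    calc p * ↑u⁻¹ = ↑u⁻¹ * (↑u * p) * ↑u⁻¹ := by simp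
      _ = ↑u⁻¹ * (p * ↑u) * ↑u⁻¹ := by rw [e1, e2]
      _ = _ := by simp [mul_assoc]
  refine ⟨hnn, by simp only [mul_assoc, mul_mul_of_mul_eq hpp, hpp], p * ↑u⁻¹ * p, ?_, ?_, ?_⟩
  · simp only [mul_assoc, mul_mul_of_mul_eq hpp, hpp]
  · rw [← e2]
    simp only [mul_assoc, mul_mul_of_mul_eq hpp, ← e3]
    rw [e3]; simp
  · rw [← e1]
    simp only [mul_assoc, mul_mul_of_mul_eq hpp]
    rw [e1, ← e2]; simp [hpp]

/-- The compression `A ↦ s* F(s A s*) s` of a map on tuples. -/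
def compression (F : (Fin k → 𝔸) → 𝔸) (s : 𝔸) (A : Fin k → 𝔸) : 𝔸 :=
  star s * F (conjTuple s A) * s

theorem isStarProjection_of_isometry {s : 𝔸} (hs : star s * s = 1) :
    IsStarProjection (s * star s) :=
  isStarProjection_mul_star (mul_one s) hs

theorem isStrictlyPositiveIn_conjTuple {s : 𝔸} (hs : star s * s = 1) {A : Fin k → 𝔸}
    (hA : ∀ i, IsStrictlyPositive (A i)) (i : Fin k) :
    IsStrictlyPositiveIn (s * star s) (conjTuple s A i) :=
  (isStrictlyPositiveIn_one (hA i)).conj (mul_one s) hs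

namespace IsRegularSublinear

variable {F : (Fin k → 𝔸) → 𝔸} (hF : IsRegularSublinear F)

include hF

theorem corner_eq {p : 𝔸} (hp : IsStarProjection p) {x : Fin k → 𝔸}
    (hx : ∀ i, IsStrictlyPositiveIn p (x i)) : p * F x * p = F x := by
  have := hF.corner_add p 0 hp (.zero _) (mul_zero p) x 0 hx fun i => isStrictlyPositiveIn_zero
  simpa using this.symm

theorem map_add {p q : 𝔸} (hp : IsStarProjection p) (hq : IsStarProjection q) (hpq : p * q = 0)
    {x y : Fin k → 𝔸} (hx : ∀ i, IsStrictlyPositiveIn p (x i))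
    (hy : ∀ i, IsStrictlyPositiveIn q (y i)) : F (x + y) = F x + F y := by
  rw [hF.corner_add p q hp hq hpq x y hx hy, hF.corner_eq hp hx, hF.corner_eq hq hy]

theorem compress_eq_zero {p : 𝔸} (hp : IsStarProjection p) {x : Fin k → 𝔸}
    (hx : ∀ i, IsStrictlyPositiveIn p (x i)) {s : 𝔸} (hs : star s * p = 0) :
    star s * F x * s = 0 := by
  rw [← hF.corner_eq hp hx]
  simp only [mul_assoc, mul_mul_of_mul_eq hs, zero_mul]

theorem compression_swap {s t p : 𝔸} (hsp : s * p = s) (hs : star s * s = p) (htp : t * p = t)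
    (ht : star t * t = p) (hst : star s * t = 0) {x : Fin k → 𝔸}
    (hx : ∀ i, IsStrictlyPositiveIn p (x i)) :
    compression F s x = compression F t x := by
  have hts : star t * s = 0 := by simpa using congrArg star hst
  have hP := isStarProjection_mul_star hsp hs
  have hQ := isStarProjection_mul_star htp ht
  have hPQ : s * star s * (t * star t) = 0 := by
    simp only [mul_assoc, mul_mul_of_mul_eq hst, zero_mul, mul_zero]
  have hQP := hP.mul_eq_zero_symm hQ hPQ
  have hPP := hP.isIdempotentElem.eq
  have hQQ := hQ.isIdempotentElem.eq
  have hPQs : IsStarProjection (s * star s + t * star t) := hP.add hQ hPQ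
  have hE : IsStarProjection (1 - (s * star s + t * star t)) := hPQs.one_sub
  set e := 1 - (s * star s + t * star t) with he
  have es : e * s = 0 := by
    simp only [he, sub_mul, add_mul, mul_assoc, hs, hts, hsp, one_mul, mul_zero, add_zero, sub_self]
  have et : e * t = 0 := by
    simp only [he, sub_mul, add_mul, mul_assoc, ht, hst, htp, one_mul, mul_zero, zero_add, sub_self]
  have se : star s * e = 0 := by
    have := congrArg star es
    simpa [hE.isSelfAdjoint.star_eq] using this
  have te : star t * e = 0 := by
    have := congrArg star et
    simpa [hE.isSelfAdjoint.star_eq] using this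
  have ee := hE.isIdempotentElem.eq
  set X : Fin k → 𝔸 := conjTuple s x + conjTuple t x + fun _ => e with hX
  have hx1 : ∀ i, IsStrictlyPositiveIn (s * star s) (conjTuple s x i) := fun i =>
    (hx i).conj hsp hs
  have hx2 : ∀ i, IsStrictlyPositiveIn (t * star t) (conjTuple t x i) := fun i =>
    (hx i).conj htp ht
  have hx12 : ∀ i, IsStrictlyPositiveIn (s * star s + t * star t)
      ((conjTuple s x + conjTuple t x) i) := fun i => (hx1 i).add (hx2 i) hP hQ hPQ
  have hPQE : (s * star s + t * star t) * e = 0 := by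
    simp only [add_mul, mul_assoc, se, te, mul_zero, add_zero]
  have hXpos : ∀ i, IsStrictlyPositive (X i) := fun i => by
    have := (hx12 i).add hE.isStrictlyPositiveIn hPQs hE hPQE
    rw [he, add_sub_cancel] at this
    exact this.isStrictlyPositive
  have hFX : F X = F (conjTuple s x) + F (conjTuple t x) + F (fun _ => e) := by
    rw [hX, hF.map_add hPQs hE hPQE hx12 (fun i => hE.isStrictlyPositiveIn),
      hF.map_add hP hQ hPQ hx1 hx2]
  have h0 : ∀ i : Fin k, IsStrictlyPositiveIn e ((fun _ => e) i) := fun i => hE.isStrictlyPositiveIn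
  have hs1 : star s * F X * s = compression F s x := by
    rw [hFX, compression, mul_add, mul_add, add_mul, add_mul,
      hF.compress_eq_zero hQ hx2 (by rw [mul_mul_of_mul_eq hst, zero_mul]),
      hF.compress_eq_zero hE h0 se, add_zero, add_zero]
  have ht1 : star t * F X * t = compression F t x := by
    rw [hFX, compression, mul_add, mul_add, add_mul, add_mul,
      hF.compress_eq_zero hP hx1 (by rw [mul_mul_of_mul_eq hts, zero_mul]),
      hF.compress_eq_zero hE h0 te, add_zero, zero_add]
  set u := s * star t + t * star s + e with hu
  have us : u * s = t := by
    simp only [hu, add_mul, mul_assoc, hs, hts, htp, es, mul_zero, add_zero, zero_add]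
  have ut : u * t = s := by
    simp only [hu, add_mul, mul_assoc, ht, hst, hsp, et, mul_zero, add_zero]
  have ue : u * e = e := by
    simp only [hu, add_mul, mul_assoc, se, te, ee, mul_zero, zero_add]
  have husa : star u = u := by
    simp only [hu, star_add, star_mul, star_star, hE.isSelfAdjoint.star_eq]
    abel
  have huu : u * u = 1 := by
    calc u * u = u * s * star t + u * t * star s + u * e := by
          conv_lhs => rw [hu, mul_add, mul_add, ← mul_assoc, ← mul_assoc]
      _ = 1 := by rw [us, ut, ue, he]; abel
  have hmem : u ∈ unitary 𝔸 := by
    rw [Unitary.mem_iff, husa]; exact ⟨huu, huu⟩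
  have hconj : conjTuple u X = X := by
    have su : star s * u = star t := by rw [← husa, ← star_mul, us]
    have tu : star t * u = star s := by rw [← husa, ← star_mul, ut]
    ext i
    simp only [hX, conjTuple_apply, Pi.add_apply, husa, mul_add, add_mul, mul_assoc, su, tu,
      mul_mul_of_mul_eq us, mul_mul_of_mul_eq ut, ue, mul_mul_of_mul_eq ue]
    have eu : e * u = e := by
      have := congrArg star ue
      rwa [star_mul, husa, hE.isSelfAdjoint.star_eq] at this
    rw [eu]
    abel
  have hmain := hF.unitary_conj u hmem X hXpos
  rw [hconj, husa] at hmain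
  have su : star s * u = star t := by rw [← husa, ← star_mul, us]
  rw [← hs1, ← ht1]
  calc star s * F X * s = star s * (u * F X * u) * s := by rw [← hmain]
    _ = star s * u * F X * (u * s) := by simp only [mul_assoc]
    _ = _ := by rw [su, us]

theorem compress_conjTuple_add {s : 𝔸} (hs : star s * s = 1) {A y : Fin k → 𝔸}
    (hA : ∀ i, IsStrictlyPositive (A i))
    (hy : ∀ i, IsStrictlyPositiveIn (1 - s * star s) (y i)) :
    star s * F (conjTuple s A + y) * s = compression F s A := by
  have hp := isStarProjection_of_isometry hs
  rw [hF.map_add hp hp.one_sub (by rw [mul_sub, mul_one, hp.isIdempotentElem.eq, sub_self])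
    (isStrictlyPositiveIn_conjTuple hs hA) hy, mul_add, add_mul,
    hF.compress_eq_zero hp.one_sub hy, add_zero, compression]
  rw [mul_sub, mul_one, mul_mul_of_mul_eq hs, one_mul, sub_self]

omit hF in
theorem _root_.isStrictlyPositive_conjTuple_add {s : 𝔸} (hs : star s * s = 1) {A y : Fin k → 𝔸}
    (hA : ∀ i, IsStrictlyPositive (A i))
    (hy : ∀ i, IsStrictlyPositiveIn (1 - s * star s) (y i)) (i : Fin k) :
    IsStrictlyPositive ((conjTuple s A + y) i) := by
  have hp := isStarProjection_of_isometry hs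
  have := (isStrictlyPositiveIn_conjTuple hs hA i).add (hy i) hp hp.one_sub
    (by rw [mul_sub, mul_one, hp.isIdempotentElem.eq, sub_self])
  rw [add_sub_cancel] at this
  exact this.isStrictlyPositive

theorem compression_unitary_mul {s u : 𝔸} (hs : star s * s = 1) (hu : u ∈ unitary 𝔸)
    {A : Fin k → 𝔸} (hA : ∀ i, IsStrictlyPositive (A i)) :
    compression F (u * s) A = compression F s A := by
  obtain ⟨hu1, hu2⟩ := Unitary.mem_iff.1 hu
  have hus : star (u * s) * (u * s) = 1 := by
    rw [star_mul, mul_assoc, mul_mul_of_mul_eq hu1, one_mul, hs]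
  have hy : ∀ {t : 𝔸}, star t * t = 1 → ∀ i : Fin k,
      IsStrictlyPositiveIn (1 - t * star t) ((fun _ => 1 - t * star t : Fin k → 𝔸) i) :=
    fun ht i => (isStarProjection_of_isometry ht).one_sub.isStrictlyPositiveIn
  have hconj : conjTuple (u * s) A + (fun _ => 1 - u * s * star (u * s)) =
      conjTuple u (conjTuple s A + fun _ => 1 - s * star s) := by
    ext i
    simp only [conjTuple_apply, Pi.add_apply, star_mul, mul_add, add_mul, mul_sub, sub_mul, mul_one,
      hu2, mul_assoc]
  rw [← hF.compress_conjTuple_add hus hA (hy hus), ← hF.compress_conjTuple_add hs hA (hy hs), hconj,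
    hF.unitary_conj u hu _ (isStrictlyPositive_conjTuple_add hs hA (hy hs))]
  simp only [star_mul, mul_assoc, mul_mul_of_mul_eq hu1, one_mul]

end IsRegularSublinear

theorem IsStrictlyPositive.compress_isometry {z x : 𝔸} (hz : star z * z = 1)
    (hx : IsStrictlyPositive x) : IsStrictlyPositive (star z * x * z) := by
  obtain ⟨r, hr, hrx⟩ := isStrictlyPositive_iff_exists_smul_one_le.1 hx
  refine isStrictlyPositive_iff_exists_smul_one_le.2 ⟨r, hr, ?_⟩
  simpa [hz] using star_left_conjugate_le_conjugate hrx z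

theorem isStrictlyPositive_conjTuple_unitary {u : 𝔸} (hu : u ∈ unitary 𝔸) {A : Fin k → 𝔸}
    (hA : ∀ i, IsStrictlyPositive (A i)) (i : Fin k) : IsStrictlyPositive (conjTuple u A i) := by
  have : star (star u) * star u = 1 := by simpa using (Unitary.mem_iff.1 hu).2
  simpa using (hA i).compress_isometry this

theorem isStrictlyPositive_add_tuple {A B : Fin k → 𝔸} (hA : ∀ i, IsStrictlyPositive (A i))
    (hB : ∀ i, IsStrictlyPositive (B i)) (i : Fin k) : IsStrictlyPositive ((A + B) i) :=
  (hA i).add_nonneg (hB i).nonneg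

theorem isStrictlyPositive_smul_tuple {A : Fin k → 𝔸} (hA : ∀ i, IsStrictlyPositive (A i)) {t : ℝ}
    (ht : 0 < t) (i : Fin k) : IsStrictlyPositive ((t • A) i) :=
  (hA i).smul ht

theorem IsSublinear.map_le_of_two_smul_eq {F : (Fin k → 𝔸) → 𝔸} (hF : IsSublinear F)
    {A B X : Fin k → 𝔸} (hA : ∀ i, IsStrictlyPositive (A i)) (hB : ∀ i, IsStrictlyPositive (B i))
    (hX : (2 : ℝ) • X = A + B) : F X ≤ (1 / 2 : ℝ) • (F A + F B) := by
  have hX' : X = (1 / 2 : ℝ) • (A + B) := by rw [← hX, smul_smul]; norm_num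
  rw [hX', hF.smul _ (by norm_num) _ (isStrictlyPositive_add_tuple hA hB)]
  exact smul_le_smul_of_nonneg_left (hF.add_le A B hA hB) (by norm_num)

theorem IsRegularSublinear.compression_compress_le {F : (Fin k → 𝔸) → 𝔸}
    (hF : IsRegularSublinear F) {z : 𝔸} (hz : star z * z = 1) {X : Fin k → 𝔸}
    (hX : ∀ i, IsStrictlyPositive (X i)) :
    compression F z (conjTuple (star z) X) ≤ star z * F X * z := by
  have hp := isStarProjection_of_isometry hz
  set p := z * star z with hpdef
  have hpp := hp.isIdempotentElem.eq
  set u := 1 - (2 : ℝ) • p with hu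
  have husa : star u = u := by simp [hu, hp.isSelfAdjoint.star_eq]
  have huu : u * u = 1 := by
    simp only [hu, mul_sub, sub_mul, mul_one, one_mul, mul_smul_comm, smul_mul_assoc, hpp]
    module
  have hmem : u ∈ unitary 𝔸 := by
    rw [Unitary.mem_iff, husa]; exact ⟨huu, huu⟩
  have huz : u * z = -z := by
    simp only [hu, sub_mul, one_mul, smul_mul_assoc, hpdef, mul_assoc, hz, mul_one]
    module
  have hzu : star z * u = -star z := by rw [← husa, ← star_mul, huz, star_neg]
  have hX' : ∀ i, IsStrictlyPositive (conjTuple (star z) X i) := fun i => by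
    simpa using (hX i).compress_isometry hz
  have hy : ∀ i, IsStrictlyPositiveIn (1 - z * star z) (conjTuple (1 - p) X i) := fun i => by
    simpa [hp.one_sub.isSelfAdjoint.star_eq, hp.isSelfAdjoint.star_eq] using
      (hX i).compress hp.one_sub
  have hY : (2 : ℝ) • (conjTuple z (conjTuple (star z) X) + conjTuple (1 - p) X) =
      X + conjTuple u X := by
    ext i
    simp only [conjTuple_conjTuple, ← hpdef, conjTuple_apply, Pi.smul_apply, Pi.add_apply, husa,
      hp.isSelfAdjoint.star_eq, hp.one_sub.isSelfAdjoint.star_eq]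
    simp only [hu, mul_sub, sub_mul, mul_one, one_mul, mul_smul_comm, smul_mul_assoc]
    module
  have h1 := hF.map_le_of_two_smul_eq hX (isStrictlyPositive_conjTuple_unitary hmem hX) hY
  have h2 := star_left_conjugate_le_conjugate h1 z
  rw [hF.compress_conjTuple_add hz hX' hy, hF.unitary_conj u hmem X hX, husa] at h2
  refine h2.trans_eq ?_
  have : star z * (u * F X * u) * z = star z * F X * z := by
    calc _ = star z * u * F X * (u * z) := by simp only [mul_assoc]
      _ = _ := by rw [huz, hzu]; simp
  rw [mul_smul_comm, smul_mul_assoc, mul_add, add_mul, this]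
  module
/-- Two isometries with orthogonal ranges adding up to the whole space. -/
structure IsHalfPair (S T : 𝔸) : Prop where
  left_isometry : star S * S = 1
  right_isometry : star T * T = 1
  orthogonal : star S * T = 0
  add_eq_one : S * star S + T * star T = 1

namespace IsHalfPair

variable {S T : 𝔸}

theorem orthogonal_symm (h : IsHalfPair S T) : star T * S = 0 := by
  simpa using congrArg star h.orthogonal

theorem symm (h : IsHalfPair S T) : IsHalfPair T S :=
  ⟨h.right_isometry, h.left_isometry, h.orthogonal_symm, by rw [add_comm, h.add_eq_one]⟩

theorem one_sub_left (h : IsHalfPair S T) : 1 - S * star S = T * star T := by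
  rw [← h.add_eq_one, add_sub_cancel_left]

theorem isometry_add (h : IsHalfPair S T) {C D : 𝔸} (hCD : star C * C + star D * D = 1) :
    star (S * C + T * D) * (S * C + T * D) = 1 := by
  simp only [star_add, star_mul, mul_add, add_mul, mul_assoc,
    mul_mul_of_mul_eq h.left_isometry, mul_mul_of_mul_eq h.right_isometry,
    mul_mul_of_mul_eq h.orthogonal, mul_mul_of_mul_eq h.orthogonal_symm, one_mul, zero_mul, mul_zero,
    add_zero, zero_add, hCD]

theorem compress_conj_add (h : IsHalfPair S T) (C D a b : 𝔸) :
    star (S * C + T * D) * (S * a * star S + T * b * star T) * (S * C + T * D) =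
      star C * a * C + star D * b * D := by
  simp only [star_add, star_mul, mul_add, add_mul, mul_assoc,
    mul_mul_of_mul_eq h.left_isometry, mul_mul_of_mul_eq h.right_isometry,
    mul_mul_of_mul_eq h.orthogonal, mul_mul_of_mul_eq h.orthogonal_symm, one_mul, zero_mul, mul_zero,
    add_zero, zero_add]

theorem isStrictlyPositiveIn_conjTuple (h : IsHalfPair S T) {A : Fin k → 𝔸}
    (hA : ∀ i, IsStrictlyPositive (A i)) (i : Fin k) :
    IsStrictlyPositiveIn (1 - S * star S) (conjTuple T A i) := by
  rw [h.one_sub_left]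
  exact _root_.isStrictlyPositiveIn_conjTuple h.right_isometry hA i

theorem isStrictlyPositive_add (h : IsHalfPair S T) {A B : Fin k → 𝔸}
    (hA : ∀ i, IsStrictlyPositive (A i)) (hB : ∀ i, IsStrictlyPositive (B i)) (i : Fin k) :
    IsStrictlyPositive ((conjTuple S A + conjTuple T B) i) :=
  isStrictlyPositive_conjTuple_add h.left_isometry hA (h.isStrictlyPositiveIn_conjTuple hB) i

theorem mem_unitary {V W : 𝔸} (h : IsHalfPair S T) (hVW : IsHalfPair V W) :
    V * star S + W * star T ∈ unitary 𝔸 := by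
  rw [Unitary.mem_iff]
  constructor
  · simp only [star_add, star_mul, mul_add, add_mul, mul_assoc, star_star,
      mul_mul_of_mul_eq hVW.left_isometry, mul_mul_of_mul_eq hVW.right_isometry,
      mul_mul_of_mul_eq hVW.orthogonal, mul_mul_of_mul_eq hVW.orthogonal_symm, one_mul, zero_mul, mul_zero,
      add_zero, zero_add, h.add_eq_one]
  · simp only [star_add, star_mul, mul_add, add_mul, mul_assoc, star_star,
      mul_mul_of_mul_eq h.left_isometry, mul_mul_of_mul_eq h.right_isometry,
      mul_mul_of_mul_eq h.orthogonal, mul_mul_of_mul_eq h.orthogonal_symm, one_mul, zero_mul, mul_zero,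
      add_zero, zero_add, hVW.add_eq_one]

end IsHalfPair

namespace IsRegularSublinear

variable {F : (Fin k → 𝔸) → 𝔸} (hF : IsRegularSublinear F) {V W S T : 𝔸} (hVW : IsHalfPair V W)

include hF

theorem compression_eq_of_orthogonal {s t : 𝔸} (hs : star s * s = 1) (ht : star t * t = 1)
    (hst : star s * t = 0) {A : Fin k → 𝔸} (hA : ∀ i, IsStrictlyPositive (A i)) :
    compression F s A = compression F t A :=
  hF.compression_swap (mul_one s) hs (mul_one t) ht hst fun i => isStrictlyPositiveIn_one (hA i)

include hVW

theorem compression_right_eq {A : Fin k → 𝔸} (hA : ∀ i, IsStrictlyPositive (A i)) :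
    compression F W A = compression F V A :=
  hF.compression_eq_of_orthogonal hVW.right_isometry hVW.left_isometry hVW.orthogonal_symm hA

theorem compression_right_mul_eq {s : 𝔸} (hs : star s * s = 1) {A : Fin k → 𝔸}
    (hA : ∀ i, IsStrictlyPositive (A i)) : compression F (W * s) A = compression F V A := by
  refine hF.compression_eq_of_orthogonal ?_ hVW.left_isometry ?_ hA
  · rw [star_mul, mul_assoc, mul_mul_of_mul_eq hVW.right_isometry, one_mul, hs]
  · rw [star_mul, mul_assoc, hVW.orthogonal_symm, mul_zero]

theorem compression_left_mul_eq {s : 𝔸} (hs : star s * s = 1) {A : Fin k → 𝔸}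
    (hA : ∀ i, IsStrictlyPositive (A i)) : compression F (V * s) A = compression F V A := by
  rw [hF.compression_right_mul_eq hVW.symm hs hA, hF.compression_right_eq hVW hA]

theorem compression_half {A : Fin k → 𝔸} (hA : ∀ i, IsStrictlyPositive (A i))
    (hST : IsHalfPair S T) : compression F S A = compression F V A := by
  have h : (V * star S + W * star T) * S = V := by
    simp only [add_mul, mul_assoc, hST.left_isometry, hST.orthogonal_symm, mul_one, mul_zero, add_zero]
  rw [← h, hF.compression_unitary_mul hST.left_isometry (hST.mem_unitary hVW) hA]

theorem compression_eq_compress_block {A B : Fin k → 𝔸} (hA : ∀ i, IsStrictlyPositive (A i))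
    (hB : ∀ i, IsStrictlyPositive (B i)) :
    star V * F (conjTuple V A + conjTuple W B) * V = compression F V A :=
  hF.compress_conjTuple_add hVW.left_isometry hA (hVW.isStrictlyPositiveIn_conjTuple hB)

theorem isSublinear_compression : IsSublinear (compression F V) where
  isSelfAdjoint A hA := by
    rw [← hF.compression_eq_compress_block hVW hA hA]
    exact (hF.isSelfAdjoint _ (hVW.isStrictlyPositive_add hA hA)).conjugate' V
  add_le A B hA hB := by
    have hAB := isStrictlyPositive_add_tuple hA hB
    rw [← hF.compression_eq_compress_block hVW hAB hAB,
      ← hF.compression_eq_compress_block hVW hA hA, ← hF.compression_eq_compress_block hVW hB hB,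
      ← add_mul, ← mul_add]
    refine (star_left_conjugate_le_conjugate ?_ V)
    refine le_of_eq_of_le ?_ (hF.add_le _ _ (hVW.isStrictlyPositive_add hA hA)
      (hVW.isStrictlyPositive_add hB hB))
    congr 1
    simp only [conjTuple_add]; abel
  smul t ht A hA := by
    have htA := isStrictlyPositive_smul_tuple hA ht
    rw [← hF.compression_eq_compress_block hVW htA htA,
      ← hF.compression_eq_compress_block hVW hA hA, conjTuple_smul, conjTuple_smul, ← smul_add,
      hF.smul t ht _ (hVW.isStrictlyPositive_add hA hA), mul_smul_comm, smul_mul_assoc]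

/-- Regularity and convexity give Jensen's inequality for isometries. -/
theorem jensen_isometry {z : 𝔸} (hz : star z * z = 1) {X : Fin k → 𝔸}
    (hX : ∀ i, IsStrictlyPositive (X i)) :
    compression F V (conjTuple (star z) X) ≤ star z * compression F V X * z := by
  have hVz : star (V * z) * (V * z) = 1 := by
    rw [star_mul, mul_assoc, mul_mul_of_mul_eq hVW.left_isometry, one_mul, hz]
  have hzX : ∀ i, IsStrictlyPositive (conjTuple (star z) X i) := fun i => by
    simpa using (hX i).compress_isometry hz
  have h := hF.compression_compress_le hVz (hVW.isStrictlyPositive_add hX hX)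
  have h1 : conjTuple (star (V * z)) (conjTuple V X + conjTuple W X) = conjTuple (star z) X := by
    ext i
    have := hVW.compress_conj_add z 0 (X i) (X i)
    simpa [mul_assoc] using this
  rw [h1, hF.compression_left_mul_eq hVW hz hzX] at h
  refine h.trans_eq ?_
  rw [← hF.compression_eq_compress_block hVW hX hX]
  simp only [star_mul, mul_assoc]

theorem compression_unitary_conj {u : 𝔸} (hu : u ∈ unitary 𝔸) {X : Fin k → 𝔸}
    (hX : ∀ i, IsStrictlyPositive (X i)) :
    compression F V (conjTuple u X) = u * compression F V X * star u := by
  obtain ⟨hu1, hu2⟩ := Unitary.mem_iff.1 hu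
  have hu2' : star (star u) * star u = 1 := by simpa using hu2
  apply le_antisymm
  · have := hF.jensen_isometry hVW hu2' hX
    simpa using this
  · have h := hF.jensen_isometry hVW hu1 (isStrictlyPositive_conjTuple_unitary hu hX)
    have h1 : conjTuple (star u) (conjTuple u X) = X := by
      rw [conjTuple_conjTuple, hu1]; ext i; simp
    rw [h1] at h
    have := star_left_conjugate_le_conjugate h (star u)
    refine le_of_le_of_eq (by simpa using this) ?_
    simp only [star_star, mul_assoc, hu2, mul_mul_of_mul_eq hu2, one_mul, mul_one]

theorem compression_block {A B : Fin k → 𝔸} (hA : ∀ i, IsStrictlyPositive (A i))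
    (hB : ∀ i, IsStrictlyPositive (B i)) (hST : IsHalfPair S T) :
    compression F V (conjTuple S A + conjTuple T B) =
      S * compression F V A * star S + T * compression F V B * star T := by
  have hiso : ∀ {s : 𝔸}, star s * s = 1 → star (V * s) * (V * s) = 1 := fun hs => by
    rw [star_mul, mul_assoc, mul_mul_of_mul_eq hVW.left_isometry, one_mul, hs]
  have hS := hiso hST.left_isometry
  have hT := hiso hST.right_isometry
  have hpq : V * S * star (V * S) * (V * T * star (V * T)) = 0 := by
    simp only [star_mul, mul_assoc, mul_mul_of_mul_eq hVW.left_isometry, one_mul,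
      mul_mul_of_mul_eq hST.orthogonal, zero_mul, mul_zero]
  have key := hF.corner_add _ _ (isStarProjection_of_isometry hS) (isStarProjection_of_isometry hT)
    hpq _ _ (isStrictlyPositiveIn_conjTuple hS hA) (isStrictlyPositiveIn_conjTuple hT hB)
  rw [compression, conjTuple_add, conjTuple_conjTuple, conjTuple_conjTuple, key,
    ← hF.compression_left_mul_eq hVW hST.left_isometry hA,
    ← hF.compression_left_mul_eq hVW hST.right_isometry hB]
  simp only [compression, star_mul, mul_assoc, mul_add, add_mul,
    mul_mul_of_mul_eq hVW.left_isometry, hVW.left_isometry, one_mul, mul_one]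

/-- Jensen's inequality for pairs of coefficients. -/
theorem jensen_pair {A B : Fin k → 𝔸} (hA : ∀ i, IsStrictlyPositive (A i))
    (hB : ∀ i, IsStrictlyPositive (B i)) {C D : 𝔸} (hCD : star C * C + star D * D = 1) :
    compression F V (conjTuple (star C) A + conjTuple (star D) B) ≤
      star C * compression F V A * C + star D * compression F V B * D := by
  have h := hF.jensen_isometry hVW (hVW.isometry_add hCD) (hVW.isStrictlyPositive_add hA hB)
  rw [hF.compression_block hVW hA hB hVW, hVW.compress_conj_add] at h
  refine le_of_eq_of_le ?_ h
  congr 1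
  ext i
  simpa using (hVW.compress_conj_add C D (A i) (B i)).symm

/-- On tuples reduced by a half projection the map agrees with its compression. -/
theorem eq_compression_of_commute {Y : Fin k → 𝔸} (hY : ∀ i, IsStrictlyPositive (Y i))
    (hST : IsHalfPair S T) (hcomm : ∀ i, Commute (S * star S) (Y i)) :
    F Y = compression F V Y := by
  have hS := isStarProjection_of_isometry hST.left_isometry
  have hT := isStarProjection_of_isometry hST.right_isometry
  have hAS : ∀ i, IsStrictlyPositive (conjTuple (star S) Y i) := fun i => by
    simpa using (hY i).compress_isometry hST.left_isometry
  have hAT : ∀ i, IsStrictlyPositive (conjTuple (star T) Y i) := fun i => by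
    simpa using (hY i).compress_isometry hST.right_isometry
  have hdec : Y = conjTuple S (conjTuple (star S) Y) + conjTuple T (conjTuple (star T) Y) := by
    ext i
    have hT' : Commute (T * star T) (Y i) := by
      rw [← hST.one_sub_left]; exact (Commute.one_left _).sub_left (hcomm i)
    simp only [Pi.add_apply, conjTuple_conjTuple, conjTuple_apply, star_mul, star_star]
    rw [(hcomm i).eq, hT'.eq, mul_assoc, mul_assoc (Y i), hS.isIdempotentElem.eq,
      hT.isIdempotentElem.eq, ← mul_add, hST.add_eq_one, mul_one]
  have hpq : S * star S * (T * star T) = 0 := by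
    simp only [mul_assoc, mul_mul_of_mul_eq hST.orthogonal, zero_mul, mul_zero]
  conv_rhs => rw [hdec]
  rw [hF.compression_block hVW hAS hAT hST]
  conv_lhs => rw [hdec]
  rw [hF.corner_add _ _ hS hT hpq _ _ (isStrictlyPositiveIn_conjTuple hST.left_isometry hAS)
    (isStrictlyPositiveIn_conjTuple hST.right_isometry hAT), ← hF.compression_half hVW hAS hST,
    ← hF.compression_half hVW hAT hST.symm]
  simp only [compression, mul_assoc]

end IsRegularSublinear
theorem IsSelfAdjoint.real_smul {a : 𝔸} (r : ℝ) (ha : IsSelfAdjoint a) : IsSelfAdjoint (r • a) :=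
  (IsSelfAdjoint.all r).smul ha

theorem isStrictlyPositive_one_add {y : 𝔸} (hy : IsSelfAdjoint y) (h : ‖y‖ ≤ 1 / 2) :
    IsStrictlyPositive (1 + y) := by
  refine isStrictlyPositive_iff_exists_smul_one_le.2 ⟨1 / 2, by norm_num, ?_⟩
  have h1 : -((1 / 2 : ℝ) • (1 : 𝔸)) ≤ y :=
    (neg_le_neg (smul_one_le_smul_one h)).trans hy.neg_norm_smul_one_le
  calc (1 / 2 : ℝ) • (1 : 𝔸) = 1 + -((1 / 2 : ℝ) • (1 : 𝔸)) := by module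
    _ ≤ 1 + y := by gcongr

theorem IsSelfAdjoint.conj_le_norm_smul {a : 𝔸} (ha : IsSelfAdjoint a) (c : 𝔸) :
    star c * a * c ≤ ‖a‖ • (star c * c) := by
  simpa using star_left_conjugate_le_conjugate ha.le_norm_smul_one c

/-- The map is bounded above, by a scalar, on a ball of self-adjoint perturbations of `1`. -/
def BddAboveNearOne (Φ : (Fin k → 𝔸) → 𝔸) (s : Finset (Fin k)) : Prop :=
  ∃ δ : ℝ, 0 < δ ∧ δ ≤ 1 / 2 ∧ ∃ M : ℝ, ∀ Y : Fin k → 𝔸, (∀ i, IsSelfAdjoint (Y i)) →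
    (∀ i, ‖Y i‖ ≤ δ) → (∀ i ∉ s, Y i = 0) → Φ (1 + Y) ≤ M • (1 : 𝔸)

theorem IsSublinear.map_one_add_le {Φ : (Fin k → 𝔸) → 𝔸} (hΦ : IsSublinear Φ)
    {Y Z : Fin k → 𝔸} (hY : ∀ i, IsStrictlyPositive ((1 + (2 : ℝ) • Y) i))
    (hZ : ∀ i, IsStrictlyPositive ((1 + (2 : ℝ) • Z) i)) {M N : ℝ}
    (hM : Φ (1 + (2 : ℝ) • Y) ≤ M • (1 : 𝔸)) (hN : Φ (1 + (2 : ℝ) • Z) ≤ N • (1 : 𝔸)) :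
    Φ (1 + (Y + Z)) ≤ ((M + N) / 2) • (1 : 𝔸) := by
  have h := hΦ.map_le_of_two_smul_eq (X := 1 + (Y + Z)) hY hZ (by module)
  calc _ ≤ _ := h
    _ ≤ (1 / 2 : ℝ) • (M • (1 : 𝔸) + N • (1 : 𝔸)) :=
        smul_le_smul_of_nonneg_left (add_le_add hM hN) (by norm_num)
    _ = _ := by module

/-- A sublinear map that is bounded above near `1` is continuous. -/
theorem IsSublinear.exists_close {Φ : (Fin k → 𝔸) → 𝔸} (hΦ : IsSublinear Φ)
    (hb : BddAboveNearOne Φ Finset.univ) {A : Fin k → 𝔸} (hA : ∀ i, IsStrictlyPositive (A i))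
    {ε : ℝ} (hε : 0 < ε) :
    ∃ η : ℝ, 0 < η ∧ ∀ B : Fin k → 𝔸, (∀ i, IsSelfAdjoint (B i)) → (∀ i, ‖B i - A i‖ ≤ η) →
      (∀ i, IsStrictlyPositive (B i)) ∧ Φ B ≤ Φ A + ε • (1 : 𝔸) ∧ Φ A ≤ Φ B + ε • (1 : 𝔸) := by
  obtain ⟨δ, hδ, hδ2, M, hM⟩ := hb
  obtain ⟨m, hm, hmA⟩ : ∃ m : ℝ, 0 < m ∧ ∀ i, (2 * m) • (1 : 𝔸) ≤ A i := by
    choose r hr hrA using fun i => isStrictlyPositive_iff_exists_smul_one_le.1 (hA i)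
    rcases isEmpty_or_nonempty (Fin k) with _ | _
    · exact ⟨1, one_pos, isEmptyElim⟩
    · obtain ⟨i₀, hi₀⟩ := Finite.exists_min r
      exact ⟨r i₀ / 2, half_pos (hr i₀), fun i =>
        (smul_one_le_smul_one (by linarith [hi₀ i])).trans (hrA i)⟩
  have hA' : ∀ i, IsStrictlyPositive ((A - m • 1) i) := fun i => by
    refine isStrictlyPositive_iff_exists_smul_one_le.2 ⟨m, hm, ?_⟩
    have := sub_le_sub_right (hmA i) (m • (1 : 𝔸))
    refine le_of_eq_of_le ?_ this
    module
  set K := ‖Φ (A - m • 1) - Φ A + (m * M) • (1 : 𝔸)‖ with hK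
  have hK0 : 0 ≤ K := norm_nonneg _
  have hKle : Φ (A - m • 1) - Φ A + (m * M) • (1 : 𝔸) ≤ K • (1 : 𝔸) :=
    IsSelfAdjoint.le_norm_smul_one
      (((hΦ.isSelfAdjoint _ hA').sub (hΦ.isSelfAdjoint _ hA)).add
        (IsSelfAdjoint.real_smul (m * M) (.one _)))
  set t := min (1 / 2) (ε / (K + 1)) with ht
  have ht0 : 0 < t := by positivity
  have ht1 : t ≤ 1 / 2 := min_le_left _ _
  have htK : t * K ≤ ε := by
    have : t ≤ ε / (K + 1) := min_le_right _ _
    rw [le_div_iff₀ (by positivity)] at this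
    nlinarith
  have key : ∀ Y : Fin k → 𝔸, (∀ i, IsSelfAdjoint (Y i)) → (∀ i, ‖Y i‖ ≤ δ * (t * m)) →
      (∀ i, IsStrictlyPositive ((A + Y) i)) ∧ Φ (A + Y) ≤ Φ A + ε • (1 : 𝔸) := by
    intro Y hY hYn
    have htm : 0 < t * m := by positivity
    have hY'sa : ∀ i, IsSelfAdjoint (((t * m)⁻¹ • Y) i) := fun i =>
      .real_smul _ (hY i)
    have hY'n : ∀ i, ‖((t * m)⁻¹ • Y) i‖ ≤ δ := fun i => by
      rw [Pi.smul_apply, norm_smul, Real.norm_of_nonneg (by positivity), inv_mul_le_iff₀ htm,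
        mul_comm]
      exact hYn i
    have hone : ∀ i, IsStrictlyPositive ((1 + (t * m)⁻¹ • Y) i) := fun i =>
      isStrictlyPositive_one_add (hY'sa i) ((hY'n i).trans hδ2)
    have hdec : A + Y = (1 - t) • A + (t • (A - m • 1) + (t * m) • (1 + (t * m)⁻¹ • Y)) := by
      rw [smul_add (t * m), smul_smul, mul_inv_cancel₀ htm.ne']
      module
    have p1 := isStrictlyPositive_smul_tuple hA (by linarith : 0 < 1 - t)
    have p2 := isStrictlyPositive_smul_tuple hA' ht0
    have p3 := isStrictlyPositive_smul_tuple hone htm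
    have p23 := isStrictlyPositive_add_tuple p2 p3
    refine ⟨by rw [hdec]; exact isStrictlyPositive_add_tuple p1 p23, ?_⟩
    calc Φ (A + Y) ≤ Φ ((1 - t) • A) + (Φ (t • (A - m • 1)) +
            Φ ((t * m) • (1 + (t * m)⁻¹ • Y))) := by
          conv_lhs => rw [hdec]
          exact (hΦ.add_le _ _ p1 p23).trans (add_le_add le_rfl (hΦ.add_le _ _ p2 p3))
      _ = (1 - t) • Φ A + (t • Φ (A - m • 1) + (t * m) • Φ (1 + (t * m)⁻¹ • Y)) := by
          rw [hΦ.smul _ (by linarith) _ hA, hΦ.smul _ ht0 _ hA', hΦ.smul _ htm _ hone]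
      _ ≤ (1 - t) • Φ A + (t • Φ (A - m • 1) + (t * m) • (M • (1 : 𝔸))) := by
          have := smul_le_smul_of_nonneg_left (hM _ hY'sa hY'n (by simp)) htm.le
          gcongr
      _ = Φ A + t • (Φ (A - m • 1) - Φ A + (m * M) • (1 : 𝔸)) := by module
      _ ≤ Φ A + t • (K • (1 : 𝔸)) := by
          have := smul_le_smul_of_nonneg_left hKle ht0.le
          gcongr
      _ ≤ Φ A + ε • (1 : 𝔸) := by
          rw [smul_smul]
          exact add_le_add le_rfl (smul_one_le_smul_one htK)
  refine ⟨δ * (t * m), by positivity, fun B hB hBA => ?_⟩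
  have hsa : ∀ i, IsSelfAdjoint ((B - A) i) := fun i => (hB i).sub (hA i).isSelfAdjoint
  obtain ⟨h1, h2⟩ := key (B - A) hsa hBA
  obtain ⟨h3, h4⟩ := key (-(B - A)) (fun i => (hsa i).neg) fun i => by
    rw [Pi.neg_apply, norm_neg]; exact hBA i
  rw [add_sub_cancel] at h1 h2
  refine ⟨h1, h2, ?_⟩
  have h5 := hΦ.map_le_of_two_smul_eq (X := A) h1 h3 (by module)
  have h6 : Φ A ≤ (1 / 2 : ℝ) • (Φ B + (Φ A + ε • (1 : 𝔸))) :=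
    h5.trans (smul_le_smul_of_nonneg_left (add_le_add le_rfl h4) (by norm_num))
  have h7 := sub_le_sub_right (smul_le_smul_of_nonneg_left h6 (zero_le_two (α := ℝ))) (Φ A)
  refine le_of_eq_of_le ?_ (h7.trans_eq ?_) <;> module

theorem norm_le_one_of_isStarProjection {p : 𝔸} (hp : IsStarProjection p) : ‖p‖ ≤ 1 := by
  rw [CStarAlgebra.norm_le_one_iff_of_nonneg p hp.nonneg]
  simpa using hp.one_sub.nonneg

theorem norm_compress_le {p : 𝔸} (hp : IsStarProjection p) (y : 𝔸) : ‖p * y * p‖ ≤ ‖y‖ := by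
  have := norm_le_one_of_isStarProjection hp
  calc ‖p * y * p‖ ≤ ‖p‖ * ‖y‖ * ‖p‖ := (norm_mul_le _ _).trans (by gcongr; exact norm_mul_le _ _)
    _ ≤ 1 * ‖y‖ * 1 := by gcongr
    _ = ‖y‖ := by ring

theorem IsHalfPair.mul_left {V W S T : 𝔸} (h : IsHalfPair V W) (hST : IsHalfPair S T) :
    IsHalfPair (W * S) (V * star V + W * T * star W) := by
  constructor
  · simp only [star_mul, mul_assoc, mul_mul_of_mul_eq h.right_isometry, hST.left_isometry, one_mul]
  · simp only [star_add, star_mul, mul_add, add_mul, mul_assoc, star_star,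
      mul_mul_of_mul_eq h.left_isometry, mul_mul_of_mul_eq h.right_isometry,
      mul_mul_of_mul_eq h.orthogonal, mul_mul_of_mul_eq h.orthogonal_symm,
      mul_mul_of_mul_eq hST.right_isometry, one_mul, zero_mul, mul_zero,
      add_zero, zero_add, h.add_eq_one]
  · simp only [star_mul, mul_add, mul_assoc, mul_mul_of_mul_eq h.orthogonal_symm,
      mul_mul_of_mul_eq h.right_isometry, mul_mul_of_mul_eq hST.orthogonal, one_mul, zero_mul,
      mul_zero, add_zero]
  · have : W * (S * (star S * star W)) + W * (T * (star T * star W)) = W * star W := by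
      have := congrArg (fun x => W * x * star W) hST.add_eq_one
      simpa only [mul_add, add_mul, mul_assoc, one_mul, mul_one] using this
    simp only [star_add, star_mul, mul_add, add_mul, mul_assoc, star_star,
      mul_mul_of_mul_eq h.left_isometry, mul_mul_of_mul_eq h.right_isometry,
      mul_mul_of_mul_eq h.orthogonal, mul_mul_of_mul_eq h.orthogonal_symm, one_mul, zero_mul,
      mul_zero, add_zero, zero_add]
    rw [add_left_comm, this, h.add_eq_one]

namespace IsRegularSublinear

variable {F : (Fin k → 𝔸) → 𝔸} (hF : IsRegularSublinear F) {V W S T : 𝔸} (hVW : IsHalfPair V W)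

include hF hVW

theorem bddAboveNearOne_singleton (i : Fin k) : BddAboveNearOne (compression F V) {i} := by
  have hG := hF.isSublinear_compression hVW
  set A : Fin k → 𝔸 := Function.update 1 i ((3 / 2 : ℝ) • (1 : 𝔸)) with hAdef
  set B : Fin k → 𝔸 := Function.update 1 i ((1 / 2 : ℝ) • (1 : 𝔸)) with hBdef
  have hupd : ∀ r : ℝ, 0 < r → ∀ j,
      IsStrictlyPositive ((Function.update 1 i (r • (1 : 𝔸)) : Fin k → 𝔸) j) := fun r hr j => by
    rcases eq_or_ne j i with rfl | hj
    · simpa using isStrictlyPositive_one.smul hr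
    · simp [Function.update_of_ne hj]
  have hA : ∀ j, IsStrictlyPositive (A j) := hupd _ (by norm_num)
  have hB : ∀ j, IsStrictlyPositive (B j) := hupd _ (by norm_num)
  refine ⟨1 / 2, by norm_num, le_rfl, ‖compression F V A‖ + ‖compression F V B‖,
    fun Y hY hYn hYs => ?_⟩
  have hsq : ∀ y : 𝔸, IsSelfAdjoint y → ‖y‖ ≤ 1 / 2 →
      ∃ C : 𝔸, star C * C = (1 / 2 : ℝ) • (1 : 𝔸) + y := fun y hy hn => by
    have h0 : 0 ≤ (1 / 2 : ℝ) • (1 : 𝔸) + y := by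
      have := (neg_le_neg (smul_one_le_smul_one hn)).trans hy.neg_norm_smul_one_le
      rwa [neg_le_iff_add_nonneg'] at this
    refine ⟨CFC.sqrt ((1 / 2 : ℝ) • (1 : 𝔸) + y), ?_⟩
    rw [(CFC.sqrt_nonneg ((1 / 2 : ℝ) • (1 : 𝔸) + y)).isSelfAdjoint.star_eq]
    exact CFC.sqrt_mul_sqrt_self _ h0
  obtain ⟨C, hC⟩ := hsq (Y i) (hY i) (hYn i)
  obtain ⟨D, hD⟩ := hsq (-Y i) (hY i).neg (by rw [norm_neg]; exact hYn i)
  have hCD : star C * C + star D * D = 1 := by rw [hC, hD]; module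
  have hle : ∀ {c d : 𝔸}, star c * c + star d * d = 1 → star c * c ≤ 1 := fun {c d} h => by
    rw [← h]; exact le_add_of_nonneg_right (star_mul_self_nonneg d)
  have h := hF.jensen_pair hVW hA hB hCD
  have heq : conjTuple (star C) A + conjTuple (star D) B = 1 + Y := by
    ext j
    rcases eq_or_ne j i with rfl | hj
    · simp only [hAdef, hBdef, Pi.add_apply, conjTuple_apply, Function.update_self, star_star,
        mul_smul_comm, smul_mul_assoc, mul_one, hC, hD, Pi.one_apply]
      module
    · simp [hAdef, hBdef, Function.update_of_ne hj, hCD, hYs j (by simpa using hj)]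
  rw [heq] at h
  refine h.trans ?_
  rw [add_smul]
  refine add_le_add (((hG.isSelfAdjoint A hA).conj_le_norm_smul C).trans ?_)
    (((hG.isSelfAdjoint B hB).conj_le_norm_smul D).trans ?_)
  · exact smul_le_smul_of_nonneg_left (hle hCD) (norm_nonneg _)
  · exact smul_le_smul_of_nonneg_left (hle (by rw [add_comm, hCD])) (norm_nonneg _)

theorem bddAboveNearOne_compression : BddAboveNearOne (compression F V) Finset.univ := by
  have hG := hF.isSublinear_compression hVW
  generalize (Finset.univ : Finset (Fin k)) = s
  induction s using Finset.induction_on with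
  | empty =>
    refine ⟨1 / 2, by norm_num, le_rfl, ‖compression F V 1‖, fun Y _ _ hY => ?_⟩
    rw [show Y = 0 from funext fun i => hY i (by simp), add_zero]
    exact (hG.isSelfAdjoint 1 fun _ => isStrictlyPositive_one).le_norm_smul_one
  | insert i s hi ih =>
    obtain ⟨δ, hδ, hδ2, M, hM⟩ := ih
    obtain ⟨δ', hδ', hδ2', N, hN⟩ := hF.bddAboveNearOne_singleton hVW i
    refine ⟨min δ δ' / 2, by positivity, ?_, (M + N) / 2, fun Y hY hYn hYs => ?_⟩
    · linarith [min_le_left δ δ']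
    have h2 : ∀ {Z : Fin k → 𝔸} {r : ℝ}, (∀ j, Z j = 0 ∨ Z j = Y j) → min δ δ' ≤ r →
        (∀ j, IsSelfAdjoint (((2 : ℝ) • Z) j)) ∧ (∀ j, ‖((2 : ℝ) • Z) j‖ ≤ r) := by
      intro Z r hZ hr
      refine ⟨fun j => .real_smul _ ?_, fun j => ?_⟩
      · rcases hZ j with h | h <;> rw [h]
        exacts [.zero _, hY j]
      · rw [Pi.smul_apply, norm_smul]
        have : ‖Z j‖ ≤ min δ δ' / 2 := by
          rcases hZ j with h | h <;> rw [h]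
          exacts [by rw [norm_zero]; positivity, hYn j]
        norm_num
        linarith
    have hdec : Y = Function.update Y i 0 + Pi.single i (Y i) := by
      ext j
      rcases eq_or_ne j i with rfl | hj
      · simp
      · simp [hj]
    have hZ1 : ∀ j, Function.update Y i 0 j = 0 ∨ Function.update Y i 0 j = Y j := fun j => by
      rcases eq_or_ne j i with rfl | hj
      · simp
      · simp [hj]
    have hZ2 : ∀ j, (Pi.single i (Y i) : Fin k → 𝔸) j = 0 ∨
        (Pi.single i (Y i) : Fin k → 𝔸) j = Y j := fun j => by
      rcases eq_or_ne j i with rfl | hj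
      · simp
      · simp [hj]
    obtain ⟨a1, a2⟩ := h2 hZ1 (min_le_left δ δ')
    obtain ⟨b1, b2⟩ := h2 hZ2 (min_le_right δ δ')
    rw [hdec]
    refine hG.map_one_add_le (fun j => isStrictlyPositive_one_add (a1 j) ((a2 j).trans hδ2))
      (fun j => isStrictlyPositive_one_add (b1 j) ((b2 j).trans hδ2'))
      (hM _ a1 a2 fun j hj => ?_) (hN _ b1 b2 fun j hj => ?_)
    · rcases eq_or_ne j i with rfl | hji
      · simp
      · simp [hji, hYs j (by simp [hj, hji])]
    · have hji : j ≠ i := by simpa using hj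
      simp [hji]

theorem bddAboveNearOne : BddAboveNearOne F Finset.univ := by
  obtain ⟨δ, hδ, hδ2, M, hM⟩ := hF.bddAboveNearOne_compression hVW
  have hcomm : ∀ {s t : 𝔸}, IsHalfPair s t → ∀ Z : Fin k → 𝔸, (∀ i, IsSelfAdjoint (Z i)) →
      (∀ i, ‖Z i‖ ≤ δ) → (∀ i, Commute (s * star s) (Z i)) →
      (∀ i, IsStrictlyPositive ((1 + Z) i)) ∧ F (1 + Z) ≤ M • (1 : 𝔸) := by
    intro s t hst Z hZ hZn hc
    have hp : ∀ i, IsStrictlyPositive ((1 + Z) i) := fun i =>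
      isStrictlyPositive_one_add (hZ i) ((hZn i).trans hδ2)
    refine ⟨hp, ?_⟩
    rw [hF.eq_compression_of_commute hVW hp hst fun i => (Commute.one_right _).add_right (hc i)]
    exact hM Z hZ hZn (by simp)
  refine ⟨δ / 12, by positivity, by linarith, M, fun Y hY hYn _ => ?_⟩
  have h2 := hVW.mul_left hVW
  have h3 := hVW.mul_left hVW.symm
  have he₁ := isStarProjection_of_isometry hVW.left_isometry
  have he₂ := isStarProjection_of_isometry h2.left_isometry
  have he₃ := isStarProjection_of_isometry h3.left_isometry
  set e₁ := V * star V with e₁def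
  set e₂ := W * V * star (W * V) with e₂def
  set e₃ := W * W * star (W * W) with e₃def
  have hsum : e₁ + e₂ + e₃ = 1 := by
    have := congrArg (fun x => W * x * star W) hVW.add_eq_one
    simp only [mul_add, add_mul, mul_one] at this
    rw [add_assoc, e₁def, e₂def, e₃def, ← hVW.add_eq_one, ← this]
    simp only [star_mul, mul_assoc]
  have h12 : e₁ * e₂ = 0 := by
    simp only [e₁def, e₂def, mul_assoc, mul_mul_of_mul_eq hVW.orthogonal, zero_mul, mul_zero]
  have h13 : e₁ * e₃ = 0 := by
    simp only [e₁def, e₃def, mul_assoc, mul_mul_of_mul_eq hVW.orthogonal, zero_mul, mul_zero]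
  have h21 := he₁.mul_eq_zero_symm he₂ h12
  have h31 := he₁.mul_eq_zero_symm he₃ h13
  have hsa : ∀ {p : 𝔸}, IsStarProjection p → ∀ y, IsSelfAdjoint y → IsSelfAdjoint (p * y * p) :=
    fun {p} hp y hy => by simpa [hp.isSelfAdjoint.star_eq] using hy.conjugate' p
  have hoff : ∀ {s t : 𝔸}, IsHalfPair s t →
      (∀ i, IsStrictlyPositive
        ((1 + fun i => (4 : ℝ) • ((1 - s * star s) * Y i * (1 - s * star s))) i)) ∧
      F (1 + fun i => (4 : ℝ) • ((1 - s * star s) * Y i * (1 - s * star s))) ≤ M • (1 : 𝔸) := by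
    intro s t hst
    have hp := isStarProjection_of_isometry hst.left_isometry
    refine hcomm hst _ (fun i => .real_smul _ (hsa hp.one_sub _ (hY i))) (fun i => ?_)
      fun i => Commute.smul_right ?_ _
    · rw [norm_smul]
      have := norm_compress_le hp.one_sub (Y i)
      have := hYn i
      norm_num
      linarith
    · have h0 : s * star s * (1 - s * star s) = 0 := by
        rw [mul_sub, mul_one, hp.isIdempotentElem.eq, sub_self]
      have h0' : (1 - s * star s) * (s * star s) = 0 := by
        rw [sub_mul, one_mul, hp.isIdempotentElem.eq, sub_self]
      rw [Commute, SemiconjBy, ← mul_assoc, ← mul_assoc, h0, mul_assoc _ _ (s * star s), h0']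
      simp
  have hdiag : (∀ i, IsStrictlyPositive
        ((1 + fun i => (4 : ℝ) • -(e₁ * Y i * e₁ + e₂ * Y i * e₂ + e₃ * Y i * e₃)) i)) ∧
      F (1 + fun i => (4 : ℝ) • -(e₁ * Y i * e₁ + e₂ * Y i * e₂ + e₃ * Y i * e₃)) ≤
        M • (1 : 𝔸) := by
    refine hcomm hVW _ (fun i => .real_smul _
      (((hsa he₁ _ (hY i)).add (hsa he₂ _ (hY i))).add (hsa he₃ _ (hY i))).neg) (fun i => ?_)
      fun i => Commute.smul_right (Commute.neg_right ?_) _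
    · rw [norm_smul, norm_neg]
      have := norm_add₃_le (a := e₁ * Y i * e₁) (b := e₂ * Y i * e₂) (c := e₃ * Y i * e₃)
      have := norm_compress_le he₁ (Y i)
      have := norm_compress_le he₂ (Y i)
      have := norm_compress_le he₃ (Y i)
      have := hYn i
      norm_num
      linarith
    · rw [Commute, SemiconjBy]
      simp only [mul_add, add_mul, mul_assoc, ← e₁def, he₁.isIdempotentElem.eq, h21, h31,
        mul_mul_of_mul_eq he₁.isIdempotentElem.eq, mul_mul_of_mul_eq h12, mul_mul_of_mul_eq h13,
        zero_mul, mul_zero]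
  obtain ⟨a1, a2⟩ := hoff hVW
  obtain ⟨b1, b2⟩ := hoff h2
  obtain ⟨c1, c2⟩ := hoff h3
  obtain ⟨d1, d2⟩ := hdiag
  have hYpos : ∀ i, IsStrictlyPositive ((1 + Y) i) := fun i =>
    isStrictlyPositive_one_add (hY i) ((hYn i).trans (by linarith))
  have ab := isStrictlyPositive_add_tuple a1 b1
  have cd := isStrictlyPositive_add_tuple c1 d1
  have h4 : F ((4 : ℝ) • (1 + Y)) ≤ (M • (1 : 𝔸) + M • (1 : 𝔸)) + (M • (1 : 𝔸) + M • (1 : 𝔸)) := by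
    refine le_of_eq_of_le ?_ ((hF.add_le _ _ ab cd).trans (add_le_add
      ((hF.add_le _ _ a1 b1).trans (add_le_add a2 b2))
      ((hF.add_le _ _ c1 d1).trans (add_le_add c2 d2))))
    congr 1
    ext i
    have he : e₃ = 1 - e₁ - e₂ := by rw [← hsum]; abel
    simp only [Pi.smul_apply, Pi.add_apply, Pi.one_apply, ← e₁def, ← e₂def, ← e₃def, he, mul_sub,
      sub_mul, mul_one, one_mul]
    module
  rw [hF.smul 4 (by norm_num) _ hYpos] at h4
  have h5 := smul_le_smul_of_nonneg_left h4 (by norm_num : (0 : ℝ) ≤ 1 / 4)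
  refine le_of_eq_of_le ?_ (h5.trans_eq ?_) <;> module

end IsRegularSublinear
theorem IsStrictlyPositive.conj_of_isUnit {a c : 𝔸} (ha : IsStrictlyPositive a) (hc : IsUnit c) :
    IsStrictlyPositive (star c * a * c) :=
  (hc.isStrictlyPositive_star_left_conjugate_iff).2 ha

/-- `h` almost commutes with `A`, vanishes on a half and is the identity on another half. -/
def HasAlmostCommutingSplitting (A : Fin k → 𝔸) : Prop :=
  ∀ η : ℝ, 0 < η → ∃ h : 𝔸, IsSelfAdjoint h ∧ (∀ i, ‖h * A i - A i * h‖ ≤ η) ∧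
    (∃ S T : 𝔸, IsHalfPair S T ∧ h * S = 0) ∧ ∃ S T : 𝔸, IsHalfPair S T ∧ h * S = S

theorem exists_cayley {h : 𝔸} (hh : IsSelfAdjoint h) :
    ∃ C D : 𝔸, IsSelfAdjoint C ∧ IsSelfAdjoint D ∧ C * C + D * D = 1 ∧ Commute C D ∧
      C + h * D = 1 ∧ D - h * C = 0 + h ∧ C + D * h = 1 ∧ D - C * h = h := by
  have hpos : IsStrictlyPositive (1 + h * h) :=
    isStrictlyPositive_one.add_nonneg (by simpa [hh.star_eq] using star_mul_self_nonneg h)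
  obtain ⟨u, hu⟩ := hpos.isUnit
  have hhu : Commute h ↑u := by
    rw [hu]; exact (Commute.one_right h).add_right ((Commute.refl h).mul_right (.refl h))
  have hg : Commute h ↑u⁻¹ := hhu.units_inv_right
  have hgsa : IsSelfAdjoint (↑u⁻¹ : 𝔸) := by
    have husa : star u = u := by
      ext; rw [Units.coe_star, hu]; exact hpos.isSelfAdjoint
    rw [IsSelfAdjoint, ← Units.coe_star, star_inv, husa]
  have hone : (↑u⁻¹ : 𝔸) + h * h * ↑u⁻¹ = 1 := by
    rw [← one_add_mul, ← hu, Units.mul_inv]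
  set g : 𝔸 := ↑u⁻¹ with hgdef
  have hhg : Commute (h * h) g := hg.mul_left hg
  have c1 : Commute (g - h * h * g) h :=
    hg.symm.sub_left (((Commute.refl h).mul_left (.refl h)).mul_left hg.symm)
  have c2 : Commute ((2 : ℝ) • (h * g)) h := ((Commute.refl h).mul_left hg.symm).smul_left _
  have c3 : Commute (g - h * h * g) g := (Commute.refl g).sub_left (hhg.mul_left (.refl g))
  have e1 : g - h * h * g + h * ((2 : ℝ) • (h * g)) = 1 := by
    rw [← hone, mul_smul_comm, ← mul_assoc]; module
  have e2 : (2 : ℝ) • (h * g) - h * (g - h * h * g) = h := by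
    calc _ = h * (g + h * h * g) := by rw [mul_sub, mul_add]; module
      _ = h := by rw [hone, mul_one]
  refine ⟨g - h * h * g, (2 : ℝ) • (h * g), ?_, ?_, ?_, (c1.mul_right c3).smul_right _, e1,
    by rw [e2, zero_add], by rw [c2.eq, e1], by rw [c1.eq, e2]⟩
  · refine hgsa.sub ?_
    rw [IsSelfAdjoint, star_mul, star_mul, hgsa.star_eq, hh.star_eq, hhg.eq]
  · refine .real_smul _ ?_
    rw [IsSelfAdjoint, star_mul, hgsa.star_eq, hh.star_eq, hg.eq]
  · calc _ = (g + h * h * g) * (g + h * h * g) := by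
          have hgh : g * h = h * g := hg.eq.symm
          have hgh' : ∀ x, g * (h * x) = h * (g * x) := fun x => by
            rw [← mul_assoc, hgh, mul_assoc]
          simp only [mul_add, add_mul, mul_sub, sub_mul, mul_smul_comm, smul_mul_assoc, mul_assoc,
            hgh', hgh]
          module
      _ = 1 := by rw [hone, mul_one]

theorem exists_almost_commuting_pair {A : Fin k → 𝔸} (hA : HasAlmostCommutingSplitting A) {η : ℝ}
    (hη : 0 < η) :
    ∃ C D : 𝔸, IsSelfAdjoint C ∧ IsSelfAdjoint D ∧ C * C + D * D = 1 ∧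
      (∃ S T : 𝔸, IsHalfPair S T ∧ C * S = 0) ∧ (∃ S T : 𝔸, IsHalfPair S T ∧ D * S = 0) ∧
      ∃ u ∈ unitary 𝔸, (∀ i, ‖star u * A i * u - A i‖ ≤ η) ∧ (∀ i, ‖u * A i * star u - A i‖ ≤ η) ∧
        ∀ a, (2 : ℝ) • (C * a * C + D * a * D) = star u * a * u + u * a * star u := by
  obtain ⟨h, hh, hcomm, ⟨S, T, hST, hS⟩, S', T', hST', hS'⟩ := hA (η / 2) (half_pos hη)
  obtain ⟨C, D, hC, hD, hCD, hc, h1, h2, h3, h4⟩ := exists_cayley hh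
  rw [zero_add] at h2
  have hI : Complex.I * Complex.I = -1 := Complex.I_mul_I
  set u := C + Complex.I • D with hu
  have hus : star u = C - Complex.I • D := by
    rw [hu, star_add, star_smul, hC.star_eq, hD.star_eq, Complex.star_def, Complex.conj_I,
      neg_smul, sub_eq_add_neg]
  have hu1 : star u * u = 1 := by
    rw [hus, hu, ← hCD]
    simp only [mul_add, sub_mul, mul_smul_comm, smul_mul_assoc, smul_smul, smul_sub, hI, hc.eq]
    module
  have hu2 : u * star u = 1 := by
    rw [hus, hu, ← hCD]
    simp only [mul_sub, add_mul, mul_smul_comm, smul_mul_assoc, smul_smul, smul_add, hI, hc.eq]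
    module
  have hmem : u ∈ unitary 𝔸 := Unitary.mem_iff.2 ⟨hu1, hu2⟩
  have hun : ‖u‖ ≤ 1 := by
    rcases subsingleton_or_nontrivial 𝔸 with _ | _
    · simp [Subsingleton.elim u 0]
    · exact (CStarRing.norm_of_mem_unitary hmem).le
  have hr : u * (1 - Complex.I • h) = 1 + Complex.I • h := by
    have : u * (1 - Complex.I • h) = (C + D * h) + Complex.I • (D - C * h) := by
      rw [hu]
      simp only [mul_sub, add_mul, mul_one, mul_smul_comm, smul_mul_assoc, smul_smul, smul_add, hI]
      module
    rw [this, h3, h4]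
  have hl : (1 - Complex.I • h) * u = 1 + Complex.I • h := by
    have : (1 - Complex.I • h) * u = (C + h * D) + Complex.I • (D - h * C) := by
      rw [hu]
      simp only [mul_add, sub_mul, one_mul, mul_smul_comm, smul_mul_assoc, smul_smul, smul_sub, hI]
      module
    rw [this, h1, h2]
  have hinv : (1 - Complex.I • h) * (1 + u) = (2 : ℝ) • (1 : 𝔸) := by
    rw [mul_add, hl, mul_one]; module
  have hAu : ∀ i, ‖u * A i - A i * u‖ ≤ η := by
    intro i
    have e1 : (u * A i - A i * u) * (1 - Complex.I • h) =
        Complex.I • ((1 + u) * (h * A i - A i * h)) := by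
      have e2 : u * (Complex.I • (h * A i)) = u * A i - (1 + Complex.I • h) * A i := by
        rw [← hr]
        simp only [mul_sub, sub_mul, mul_one, mul_assoc, smul_mul_assoc, mul_smul_comm]
        abel
      calc _ = u * A i - u * (Complex.I • (A i * h)) - A i * (u * (1 - Complex.I • h)) := by
            simp only [mul_sub, sub_mul, mul_one, mul_assoc, mul_smul_comm]
            module
        _ = (u * (Complex.I • (h * A i)) + (1 + Complex.I • h) * A i)
            - u * (Complex.I • (A i * h)) - A i * (1 + Complex.I • h) := by rw [e2, hr]; abel
        _ = _ := by
            simp only [mul_sub, mul_add, add_mul, one_mul, mul_one, mul_assoc, mul_smul_comm,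
              smul_mul_assoc]
            module
    have e3 : (2 : ℝ) • (u * A i - A i * u) =
        Complex.I • ((1 + u) * (h * A i - A i * h) * (1 + u)) := by
      rw [← smul_mul_assoc, ← e1, mul_assoc, hinv, mul_smul_comm, mul_one]
    have h2u : ‖1 + u‖ ≤ 2 := by
      have := norm_add_le (1 : 𝔸) u
      have := norm_le_one_of_isStarProjection (.one 𝔸)
      linarith
    have e4 := congrArg norm e3
    rw [norm_smul, norm_smul, Complex.norm_I, one_mul, Real.norm_of_nonneg zero_le_two] at e4
    have e5 : ‖(1 + u) * (h * A i - A i * h) * (1 + u)‖ ≤ 2 * (η / 2) * 2 := by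
      refine (norm_mul_le _ _).trans (mul_le_mul ?_ h2u (norm_nonneg _) (by positivity))
      exact (norm_mul_le _ _).trans (mul_le_mul h2u (hcomm i) (norm_nonneg _) zero_le_two)
    linarith
  refine ⟨C, D, hC, hD, hCD, ⟨S', T', hST', ?_⟩, ⟨S, T, hST, ?_⟩, u, hmem, fun i => ?_, fun i => ?_,
    fun a => ?_⟩
  · have e1 : C * S' + D * S' = S' := by
      have := congrArg (· * S') h3
      simpa only [add_mul, mul_assoc, hS', one_mul] using this
    have e2 : D * S' - C * S' = S' := by
      have := congrArg (· * S') h4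
      simpa only [sub_mul, mul_assoc, hS'] using this
    have e3 : (2 : ℝ) • (C * S') = 0 := by
      calc (2 : ℝ) • (C * S') = (C * S' + D * S') - (D * S' - C * S') := by module
        _ = 0 := by rw [e1, e2, sub_self]
    simpa using e3
  · have := congrArg (· * S) h4
    simpa only [sub_mul, mul_assoc, hS, mul_zero, sub_zero] using this
  · have : star u * A i * u - A i = -(star u * (u * A i - A i * u)) := by
      rw [mul_sub, ← mul_assoc, hu1, one_mul, ← mul_assoc, neg_sub]
    rw [this, norm_neg]
    refine (norm_mul_le _ _).trans ?_
    rw [norm_star]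
    calc ‖u‖ * _ ≤ 1 * η := by gcongr; exact hAu i
      _ = η := one_mul η
  · have : u * A i * star u - A i = (u * A i - A i * u) * star u := by
      rw [sub_mul, mul_assoc (A i), hu2, mul_one]
    rw [this]
    refine (norm_mul_le _ _).trans ?_
    rw [norm_star]
    calc _ * ‖u‖ ≤ η * 1 := by gcongr; exact hAu i
      _ = η := mul_one η
  · rw [hus, hu]
    simp only [mul_add, sub_mul, mul_sub, add_mul, mul_smul_comm, smul_mul_assoc, smul_smul,
      smul_sub, smul_add, hI]
    module

namespace IsRegularSublinear

variable {F : (Fin k → 𝔸) → 𝔸} (hF : IsRegularSublinear F) {V W S T : 𝔸} (hVW : IsHalfPair V W)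

include hF hVW

theorem compression_conj_le_of_contraction {A : Fin k → 𝔸} (hA : ∀ i, IsStrictlyPositive (A i))
    {C : 𝔸} (hC : IsUnit C) (hC1 : star C * C ≤ 1) :
    compression F V (conjTuple (star C) A) ≤ star C * compression F V A * C := by
  have hG := hF.isSublinear_compression hVW
  have hCA : ∀ i, IsStrictlyPositive (conjTuple (star C) A i) := fun i => by
    simpa using (hA i).conj_of_isUnit hC
  have hone : ∀ i, IsStrictlyPositive ((1 : Fin k → 𝔸) i) := fun i => isStrictlyPositive_one
  set D := CFC.sqrt (1 - star C * C) with hD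
  have hDsa : IsSelfAdjoint D := (CFC.sqrt_nonneg _).isSelfAdjoint
  have hDD : star D * D = 1 - star C * C := by
    rw [hDsa.star_eq]
    exact CFC.sqrt_mul_sqrt_self _ (sub_nonneg.2 hC1)
  refine le_of_forall_pos_le_add_smul_one fun e he => ?_
  obtain ⟨η, hη, hclose⟩ := hG.exists_close (hF.bddAboveNearOne_compression hVW) hCA (half_pos he)
  have hG1 : IsSelfAdjoint (star D * compression F V 1 * D) := (hG.isSelfAdjoint 1 hone).conjugate' D
  set K := ‖star D * compression F V 1 * D‖ with hK
  set ε := min (η / (‖star D * D‖ + 1)) (e / 2 / (K + 1)) with hε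
  have hε0 : 0 < ε := by positivity
  have hε1 : ε * ‖star D * D‖ ≤ η := by
    have : ε ≤ η / (‖star D * D‖ + 1) := min_le_left _ _
    rw [le_div_iff₀ (by positivity)] at this
    linarith
  have hε2 : ε * K ≤ e / 2 := by
    have : ε ≤ e / 2 / (K + 1) := min_le_right _ _
    rw [le_div_iff₀ (by positivity)] at this
    linarith
  have hj := hF.jensen_pair hVW hA (isStrictlyPositive_smul_tuple hone hε0)
    (by rw [hDD]; abel : star C * C + star D * D = 1)
  have hB : ∀ i, (conjTuple (star C) A + conjTuple (star D) (ε • (1 : Fin k → 𝔸))) i -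
      conjTuple (star C) A i = ε • (star D * D) := fun i => by simp
  obtain ⟨-, -, h⟩ := hclose (conjTuple (star C) A + conjTuple (star D) (ε • (1 : Fin k → 𝔸)))
    (fun i => by
      rw [← sub_add_cancel ((conjTuple (star C) A + conjTuple (star D) (ε • (1 : Fin k → 𝔸))) i)
        (conjTuple (star C) A i), hB]
      exact (IsSelfAdjoint.real_smul _ (.star_mul_self D)).add (hCA i).isSelfAdjoint)
    (fun i => by rw [hB, norm_smul, Real.norm_of_nonneg hε0.le]; exact hε1)
  rw [hG.smul ε hε0 1 hone, mul_smul_comm, smul_mul_assoc] at hj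
  calc _ ≤ _ := h
    _ ≤ star C * compression F V A * C + ε • (K • (1 : 𝔸)) + (e / 2) • (1 : 𝔸) := by
        refine add_le_add (hj.trans (add_le_add le_rfl ?_)) le_rfl
        exact smul_le_smul_of_nonneg_left hG1.le_norm_smul_one hε0.le
    _ ≤ star C * compression F V A * C + (e / 2) • (1 : 𝔸) + (e / 2) • (1 : 𝔸) := by
        rw [smul_smul]
        have := smul_one_le_smul_one (𝔸 := 𝔸) hε2
        gcongr
    _ = _ := by module

theorem compression_conj_le {A : Fin k → 𝔸} (hA : ∀ i, IsStrictlyPositive (A i))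
    {C : 𝔸} (hC : IsUnit C) :
    compression F V (conjTuple (star C) A) ≤ star C * compression F V A * C := by
  have hG := hF.isSublinear_compression hVW
  set r := ‖C‖ + 1 with hr
  have hr0 : 0 < r := by positivity
  have hCA : ∀ i, IsStrictlyPositive (conjTuple (star C) A i) := fun i => by
    simpa using (hA i).conj_of_isUnit hC
  have hC1 : star (r⁻¹ • C) * (r⁻¹ • C) ≤ 1 := by
    have h1 := (IsSelfAdjoint.star_mul_self C).le_norm_smul_one
    rw [CStarRing.norm_star_mul_self] at h1
    have h2 : star C * C ≤ (r * r) • (1 : 𝔸) := h1.trans (smul_one_le_smul_one (by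
      have := norm_nonneg C
      nlinarith))
    have h3 := smul_le_smul_of_nonneg_left h2 (by positivity : 0 ≤ r⁻¹ * r⁻¹)
    rw [smul_smul, show r⁻¹ * r⁻¹ * (r * r) = 1 by field_simp, one_smul] at h3
    simpa [smul_smul] using h3
  have h := hF.compression_conj_le_of_contraction hVW hA
    (hC.smul (Units.mk0 r⁻¹ (by positivity))) hC1
  have h1 : conjTuple (star (r⁻¹ • C)) A = (r⁻¹ * r⁻¹) • conjTuple (star C) A := by
    ext i; simp [smul_smul]
  rw [show (Units.mk0 r⁻¹ (by positivity) : ℝˣ) • C = r⁻¹ • C from rfl, h1,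
    hG.smul _ (by positivity) _ hCA] at h
  have h3 := smul_le_smul_of_nonneg_left h (by positivity : 0 ≤ r * r)
  rw [smul_smul, show r * r * (r⁻¹ * r⁻¹) = 1 by field_simp, one_smul] at h3
  refine h3.trans_eq ?_
  simp only [star_smul, smul_mul_assoc, mul_smul_comm, smul_smul, star_trivial]
  rw [show r * r * (r⁻¹ * r⁻¹) = 1 by field_simp, one_smul]

theorem compression_conj {A : Fin k → 𝔸} (hA : ∀ i, IsStrictlyPositive (A i))
    {C : 𝔸} (hC : IsUnit C) :
    compression F V (conjTuple (star C) A) = star C * compression F V A * C := by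
  refine (hF.compression_conj_le hVW hA hC).antisymm ?_
  obtain ⟨c, rfl⟩ := hC
  have hCA : ∀ i, IsStrictlyPositive (conjTuple (star (c : 𝔸)) A i) := fun i => by
    simpa using (hA i).conj_of_isUnit c.isUnit
  have h := hF.compression_conj_le hVW hCA c⁻¹.isUnit
  have hs : star (↑c⁻¹ : 𝔸) * star (c : 𝔸) = 1 := by rw [← star_mul, Units.mul_inv, star_one]
  have hs' : star (c : 𝔸) * star (↑c⁻¹ : 𝔸) = 1 := by rw [← star_mul, Units.inv_mul, star_one]
  have h1 : conjTuple (star (↑c⁻¹ : 𝔸)) (conjTuple (star (c : 𝔸)) A) = A := by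
    rw [conjTuple_conjTuple, hs]; ext i; simp
  rw [h1] at h
  refine (star_left_conjugate_le_conjugate h (c : 𝔸)).trans_eq ?_
  simp only [mul_assoc, mul_mul_of_mul_eq hs', Units.inv_mul, one_mul, mul_one]

theorem eq_compression {A : Fin k → 𝔸} (hA : ∀ i, IsStrictlyPositive (A i))
    (hsplit : HasAlmostCommutingSplitting A) : F A = compression F V A := by
  have hG := hF.isSublinear_compression hVW
  have hone : ∀ i, IsStrictlyPositive ((1 : Fin k → 𝔸) i) := fun i => isStrictlyPositive_one
  have hsq : ∀ {c : 𝔸}, IsSelfAdjoint c → star c * c = c * c := fun hc => by rw [hc.star_eq]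
  have main : ∀ e : ℝ, 0 < e →
      F A ≤ compression F V A + (3 * e) • (1 : 𝔸) ∧ compression F V A ≤ F A + (2 * e) • (1 : 𝔸) := by
    intro e he
    obtain ⟨η₁, hη₁, hcl₁⟩ := hF.exists_close (hF.bddAboveNearOne hVW) hA he
    obtain ⟨η₂, hη₂, hcl₂⟩ := hG.exists_close (hF.bddAboveNearOne_compression hVW) hA he
    set η := min η₁ η₂ with hη
    have hη0 : 0 < η := by positivity
    have hle₁ : η ≤ η₁ := min_le_left _ _
    have hle₂ : η ≤ η₂ := min_le_right _ _
    obtain ⟨C, D, hC, hD, hCD, ⟨S, T, hST, hS⟩, ⟨S', T', hST', hS'⟩, u, hu, hn₁, hn₂, havg⟩ :=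
      exists_almost_commuting_pair hsplit (half_pos hη0)
    have hu' : star u ∈ unitary 𝔸 := Unitary.star_mem hu
    have hCDs : star C * C + star D * D = 1 := by rw [hsq hC, hsq hD, hCD]
    have hDCs : star D * D + star C * C = 1 := by rw [add_comm, hCDs]
    set R : Fin k → 𝔸 := conjTuple (star C) A + conjTuple (star D) A with hR
    have hRavg : ∀ i, R i - A i =
        (1 / 2 : ℝ) • ((star u * A i * u - A i) + (u * A i * star u - A i)) := fun i => by
      have h1 : R i = C * A i * C + D * A i * D := by simp [hR, hC.star_eq, hD.star_eq]
      have h2 : C * A i * C + D * A i * D = (1 / 2 : ℝ) • (star u * A i * u + u * A i * star u) := by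
        rw [← havg, smul_smul]; norm_num
      rw [h1, h2]; module
    have hRn : ∀ i, ‖R i - A i‖ ≤ η / 2 := fun i => by
      rw [hRavg, norm_smul]
      have := norm_add_le (star u * A i * u - A i) (u * A i * star u - A i)
      have := hn₁ i
      have := hn₂ i
      norm_num
      linarith
    have hRsa : ∀ i, IsSelfAdjoint (R i) := fun i => by
      have h1 := ((hA i).isSelfAdjoint.conjugate' C)
      have h2 := ((hA i).isSelfAdjoint.conjugate' D)
      simpa [hR] using h1.add h2
    have hconj₁ : ∀ i, conjTuple (star u) A i = star u * A i * u := fun i => by simp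
    constructor
    · have hGone := hG.isSelfAdjoint 1 hone
      set K := ‖compression F V 1‖ with hK
      set ε := min (η / 2) (e / (K + 1)) with hε
      have hε0 : 0 < ε := by positivity
      have hεη : ε ≤ η / 2 := min_le_left _ _
      have hεK : ε * K ≤ e := by
        have : ε ≤ e / (K + 1) := min_le_right _ _
        rw [le_div_iff₀ (by positivity)] at this
        linarith
      have hε1 := isStrictlyPositive_smul_tuple hone hε0
      have hpair : ∀ {c d : 𝔸}, IsSelfAdjoint c → IsSelfAdjoint d → c * c + d * d = 1 →
          (∃ s t : 𝔸, IsHalfPair s t ∧ c * s = 0) →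
          (∀ i, IsStrictlyPositive
            ((conjTuple (star c) A + conjTuple (star d) (ε • (1 : Fin k → 𝔸))) i)) ∧
          F (conjTuple (star c) A + conjTuple (star d) (ε • (1 : Fin k → 𝔸))) ≤
            c * compression F V A * c + ε • (d * compression F V 1 * d) := by
        rintro c d hc hd hcd ⟨s, t, hst, hcs⟩
        have hcd' : star c * c + star d * d = 1 := by rw [hsq hc, hsq hd, hcd]
        have hY : ∀ i, IsStrictlyPositive
            ((conjTuple (star c) A + conjTuple (star d) (ε • (1 : Fin k → 𝔸))) i) := fun i => by
          have := (hVW.isStrictlyPositive_add hA hε1 i).compress_isometry (hVW.isometry_add hcd')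
          simp only [Pi.add_apply, conjTuple_apply] at this
          rw [hVW.compress_conj_add] at this
          simpa using this
        refine ⟨hY, ?_⟩
        have hsc : star s * c = 0 := by simpa [hc.star_eq] using congrArg star hcs
        have hdd : d * d = 1 - c * c := by rw [← hcd]; abel
        rw [hF.eq_compression_of_commute hVW hY hst fun i => ?_]
        · have := hF.jensen_pair hVW hA hε1 hcd'
          rw [hG.smul ε hε0 1 hone, mul_smul_comm, smul_mul_assoc] at this
          simpa only [hc.star_eq, hd.star_eq] using this
        · rw [Commute, SemiconjBy]
          simp only [Pi.add_apply, conjTuple_apply, Pi.smul_apply, Pi.one_apply, mul_smul_comm,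
            smul_mul_assoc, mul_one, hd.star_eq, hc.star_eq, hdd, mul_add, add_mul, mul_sub, sub_mul,
            one_mul, mul_assoc, hcs, hsc, mul_mul_of_mul_eq hcs, mul_mul_of_mul_eq hsc, zero_mul,
            mul_zero]
      obtain ⟨p₁, b₁⟩ := hpair hC hD hCD ⟨S, T, hST, hS⟩
      obtain ⟨p₂, b₂⟩ := hpair hD hC (by rw [add_comm, hCD]) ⟨S', T', hST', hS'⟩
      have hsum : conjTuple (star C) A + conjTuple (star D) (ε • (1 : Fin k → 𝔸)) +
          (conjTuple (star D) A + conjTuple (star C) (ε • (1 : Fin k → 𝔸))) =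
          R + ε • (1 : Fin k → 𝔸) := by
        rw [hR]
        ext i
        simp only [Pi.add_apply, conjTuple_apply, Pi.smul_apply, Pi.one_apply, mul_smul_comm,
          smul_mul_assoc, mul_one, star_star]
        rw [← hCDs]
        module
      obtain ⟨-, -, hcl⟩ := hcl₁ (R + ε • (1 : Fin k → 𝔸))
        (fun i => (hRsa i).add (.real_smul _ (.one _))) (fun i => by
          have h1 : (R + ε • (1 : Fin k → 𝔸)) i - A i = (R i - A i) + ε • (1 : 𝔸) := by
            simp only [Pi.add_apply, Pi.smul_apply, Pi.one_apply]; abel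
          rw [h1]
          refine (norm_add_le _ _).trans ?_
          have h2 : ‖ε • (1 : 𝔸)‖ ≤ ε := by
            rw [norm_smul, Real.norm_of_nonneg hε0.le]
            exact mul_le_of_le_one_right hε0.le (norm_le_one_of_isStarProjection (.one 𝔸))
          linarith [hRn i])
      obtain ⟨-, g₁, -⟩ := hcl₂ (conjTuple (star u) A)
        (fun i => by simpa using (hA i).isSelfAdjoint.conjugate' u)
        (fun i => by rw [hconj₁]; linarith [hn₁ i])
      obtain ⟨-, g₂, -⟩ := hcl₂ (conjTuple u A)
        (fun i => by simpa using (hA i).isSelfAdjoint.conjugate u)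
        (fun i => by rw [conjTuple_apply]; linarith [hn₂ i])
      rw [hF.compression_unitary_conj hVW hu' hA, star_star] at g₁
      rw [hF.compression_unitary_conj hVW hu hA] at g₂
      have hlast : C * compression F V A * C + D * compression F V A * D ≤
          compression F V A + e • (1 : 𝔸) := by
        have h1 : C * compression F V A * C + D * compression F V A * D = (1 / 2 : ℝ) •
            (star u * compression F V A * u + u * compression F V A * star u) := by
          rw [← havg, smul_smul]; norm_num
        rw [h1]
        refine (smul_le_smul_of_nonneg_left (add_le_add g₁ g₂) (by norm_num)).trans_eq ?_
        module
      have hKle : D * compression F V 1 * D + C * compression F V 1 * C ≤ K • (1 : 𝔸) := by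
        have h := add_le_add (hGone.conj_le_norm_smul D) (hGone.conj_le_norm_smul C)
        rwa [← smul_add, hDCs, hC.star_eq, hD.star_eq] at h
      calc F A ≤ F (R + ε • (1 : Fin k → 𝔸)) + e • (1 : 𝔸) := hcl
        _ ≤ (C * compression F V A * C + ε • (D * compression F V 1 * D)) +
            (D * compression F V A * D + ε • (C * compression F V 1 * C)) + e • (1 : 𝔸) := by
          rw [← hsum]
          exact add_le_add ((hF.add_le _ _ p₁ p₂).trans (add_le_add b₁ b₂)) le_rfl
        _ = (C * compression F V A * C + D * compression F V A * D) +
            ε • (D * compression F V 1 * D + C * compression F V 1 * C) + e • (1 : 𝔸) := by module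
        _ ≤ (compression F V A + e • (1 : 𝔸)) + ε • (K • (1 : 𝔸)) + e • (1 : 𝔸) := by
          have := smul_le_smul_of_nonneg_left hKle hε0.le
          gcongr
        _ ≤ (compression F V A + e • (1 : 𝔸)) + e • (1 : 𝔸) + e • (1 : 𝔸) := by
          rw [smul_smul]
          have := smul_one_le_smul_one (𝔸 := 𝔸) hεK
          gcongr
        _ = _ := by module
    · obtain ⟨-, -, hcl⟩ := hcl₂ R hRsa fun i => by linarith [hRn i]
      have hpart : ∀ {c s t : 𝔸}, IsSelfAdjoint c → IsHalfPair s t → c * s = 0 →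
          (∀ i, IsStrictlyPositive (conjTuple (star t) A i)) ∧ c * t * star t = c ∧
          t * (star t * c) = c ∧
          compression F V (conjTuple (star t) A) ≤ star t * F A * t := by
        intro c s t hc hst hcs
        have hp : ∀ i, IsStrictlyPositive (conjTuple (star t) A i) := fun i => by
          simpa using (hA i).compress_isometry hst.right_isometry
        have h1 : c * t * star t = c := by
          rw [mul_assoc, ← hst.one_sub_left, mul_sub, mul_one, ← mul_assoc, hcs, zero_mul, sub_zero]
        refine ⟨hp, h1, ?_, ?_⟩
        · simpa [hc.star_eq] using congrArg star h1
        · rw [← hF.compression_half hVW hp hst.symm]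
          exact hF.compression_compress_le hst.right_isometry hA
      obtain ⟨p₁, c₁, d₁, b₁⟩ := hpart hC hST hS
      obtain ⟨p₂, c₂, d₂, b₂⟩ := hpart hD hST' hS'
      have hCD' : star (star T * C) * (star T * C) + star (star T' * D) * (star T' * D) = 1 := by
        simp only [star_mul, star_star, hC.star_eq, hD.star_eq, mul_assoc, d₁, d₂, hCD]
      have hj := hF.jensen_pair hVW p₁ p₂ hCD'
      have hRe : conjTuple (star (star T * C)) (conjTuple (star T) A) +
          conjTuple (star (star T' * D)) (conjTuple (star T') A) = R := by
        rw [hR]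
        simp only [conjTuple_conjTuple, star_mul, star_star, hC.star_eq, hD.star_eq, c₁, c₂]
      have e₁ := star_left_conjugate_le_conjugate b₁ (star T * C)
      have e₂ := star_left_conjugate_le_conjugate b₂ (star T' * D)
      have f₁ : star (star T * C) * (star T * F A * T) * (star T * C) = C * F A * C := by
        calc _ = (C * T * star T) * F A * (T * (star T * C)) := by
              simp only [star_mul, star_star, hC.star_eq, mul_assoc]
          _ = _ := by rw [c₁, d₁]
      have f₂ : star (star T' * D) * (star T' * F A * T') * (star T' * D) = D * F A * D := by
        calc _ = (D * T' * star T') * F A * (T' * (star T' * D)) := by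
              simp only [star_mul, star_star, hD.star_eq, mul_assoc]
          _ = _ := by rw [c₂, d₂]
      rw [f₁] at e₁
      rw [f₂] at e₂
      rw [hRe] at hj
      obtain ⟨-, g₁, -⟩ := hcl₁ (conjTuple (star u) A)
        (fun i => by simpa using (hA i).isSelfAdjoint.conjugate' u)
        (fun i => by rw [hconj₁]; linarith [hn₁ i])
      obtain ⟨-, g₂, -⟩ := hcl₁ (conjTuple u A)
        (fun i => by simpa using (hA i).isSelfAdjoint.conjugate u)
        (fun i => by rw [conjTuple_apply]; linarith [hn₂ i])
      rw [hF.unitary_conj _ hu' _ hA, star_star] at g₁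
      rw [hF.unitary_conj _ hu _ hA] at g₂
      have hlast : C * F A * C + D * F A * D ≤ F A + e • (1 : 𝔸) := by
        have h1 : C * F A * C + D * F A * D = (1 / 2 : ℝ) •
            (star u * F A * u + u * F A * star u) := by
          rw [← havg, smul_smul]; norm_num
        rw [h1]
        refine (smul_le_smul_of_nonneg_left (add_le_add g₁ g₂) (by norm_num)).trans_eq ?_
        module
      calc compression F V A ≤ compression F V R + e • (1 : 𝔸) := hcl
        _ ≤ F A + e • (1 : 𝔸) + e • (1 : 𝔸) :=
          add_le_add (hj.trans ((add_le_add e₁ e₂).trans hlast)) le_rfl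
        _ = _ := by module
  apply le_antisymm
  · refine le_of_forall_pos_le_add_smul_one fun e he => ?_
    simpa [mul_div_cancel₀] using (main (e / 3) (by positivity)).1
  · refine le_of_forall_pos_le_add_smul_one fun e he => ?_
    simpa [mul_div_cancel₀] using (main (e / 2) (by positivity)).2

end IsRegularSublinear

theorem IsRegularSublinear.compress_eq_compress_compression {F : (Fin k → 𝔸) → 𝔸}
    (hF : IsRegularSublinear F) {V p w : 𝔸} (hV : star V * V = 1) (hp : IsStarProjection p)
    {A : Fin k → 𝔸} (hA : ∀ i, IsStrictlyPositive (A i)) (hcomm : ∀ i, Commute p (A i))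
    (hwp : w * p = w) (hw : star w * w = p) (hpw : p * w = 0) (hVw : star (V * p) * w = 0) :
    p * F A * p = p * compression F V A * p := by
  have hpp : p * p = p := hp.isIdempotentElem.eq
  have hps : star p = p := hp.isSelfAdjoint.star_eq
  have hq := hp.one_sub
  have hqq := hq.isIdempotentElem.eq
  have hqs := hq.isSelfAdjoint.star_eq
  have hpq : p * (1 - p) = 0 := by rw [mul_sub, mul_one, hpp, sub_self]
  set q := 1 - p with hqdef
  set y : Fin k → 𝔸 := fun i => p * A i * p with hydef
  set z : Fin k → 𝔸 := fun i => q * A i * q with hzdef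
  have hy : ∀ i, IsStrictlyPositiveIn p (y i) := fun i => (hA i).compress hp
  have hz : ∀ i, IsStrictlyPositiveIn q (z i) := fun i => (hA i).compress hq
  have hAyz : A = y + z := by
    ext i
    have hpA : p * (A i * p) = A i * p := by rw [← (hcomm i).eq, ← mul_assoc, hpp]
    simp only [hydef, hzdef, hqdef, Pi.add_apply, mul_assoc, hpA, (hcomm i).eq, mul_sub, sub_mul,
      mul_one, one_mul]
    abel
  have hconj : ∀ {r : 𝔸} {x : Fin k → 𝔸}, IsStarProjection r →
      (∀ i, IsStrictlyPositiveIn r (x i)) → conjTuple (V * r) x = conjTuple V x := by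
    intro r x hr hx
    ext i
    simp only [conjTuple_apply, star_mul, hr.isSelfAdjoint.star_eq, mul_assoc]
    rw [mul_mul_of_mul_eq ((hx i).left hr), mul_mul_of_mul_eq ((hx i).right hr)]
  have hiso : ∀ {r : 𝔸}, IsStarProjection r → V * r * r = V * r ∧ star (V * r) * (V * r) = r := by
    intro r hr
    rw [star_mul, hr.isSelfAdjoint.star_eq, mul_assoc, mul_assoc, mul_mul_of_mul_eq hV, one_mul,
      hr.isIdempotentElem.eq]
    exact ⟨rfl, rfl⟩
  have hleft : p * F A * p = compression F p y := by
    have hpy : conjTuple p y = y := by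
      ext i
      simp only [conjTuple_apply, hps]
      rw [(hy i).left hp, (hy i).right hp]
    rw [compression, hpy, hps, hAyz, hF.map_add hp hq hpq hy hz, mul_add, add_mul,
      show p * F z * p = 0 by
        simpa [hps] using hF.compress_eq_zero hq hz (s := p) (by rw [hps, hpq]), add_zero]
  have hright : p * compression F V A * p = compression F (V * p) y := by
    have hVy : ∀ i, IsStrictlyPositiveIn (V * p * star (V * p)) (conjTuple (V * p) y i) :=
      fun i => (hy i).conj (hiso hp).1 (hiso hp).2
    have hVz : ∀ i, IsStrictlyPositiveIn (V * q * star (V * q)) (conjTuple (V * q) z i) :=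
      fun i => (hz i).conj (hiso hq).1 (hiso hq).2
    have hpqV : star (V * p) * (V * q) = 0 := by
      rw [star_mul, hps, mul_assoc, mul_mul_of_mul_eq hV, one_mul, hpq]
    have hzero := hF.compress_eq_zero (isStarProjection_mul_star (hiso hq).1 (hiso hq).2) hVz
      (s := V * p) (by rw [mul_mul_of_mul_eq hpqV, zero_mul])
    have hsum : conjTuple V A = conjTuple (V * p) y + conjTuple (V * q) z := by
      rw [hconj hp hy, hconj hq hz, ← conjTuple_add, ← hAyz]
    rw [show p * compression F V A * p = star (V * p) * F (conjTuple V A) * (V * p) by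
      simp only [compression, star_mul, hps, mul_assoc], hsum,
      hF.map_add (isStarProjection_mul_star (hiso hp).1 (hiso hp).2)
        (isStarProjection_mul_star (hiso hq).1 (hiso hq).2)
        (by rw [mul_assoc, mul_mul_of_mul_eq hpqV, zero_mul, mul_zero]) hVy hVz,
      mul_add, add_mul, hzero, add_zero, compression]
  rw [hleft, hright, hF.compression_swap hpp (by rw [hps, hpp]) hwp hw (by rw [hps, hpw]) hy,
    hF.compression_swap (hiso hp).1 (hiso hp).2 hwp hw hVw hy]

/-- Commutators with every other projection of a flag moved by `A` one step at a time are mutually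
orthogonal, so the norm of their sum grows only like the square root of their number. -/
theorem norm_sq_commutator_sum_le {Q : ℕ → 𝔸} (hQ : ∀ j, IsStarProjection (Q j))
    (hmono : ∀ a b, a ≤ b → Q b * Q a = Q a) {A : 𝔸} (hA : IsSelfAdjoint A)
    (hstep : ∀ a, Q (a + 1) * (A * Q a) = A * Q a) (n : ℕ) :
    ‖(∑ j ∈ Finset.range n, Q (2 * j)) * A - A * ∑ j ∈ Finset.range n, Q (2 * j)‖ ^ 2 ≤
      n * (2 * ‖A‖) ^ 2 := by
  set K : ℕ → 𝔸 := fun j => Q (2 * j) * A - A * Q (2 * j) with hK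
  have hQs : ∀ j, star (Q j) = Q j := fun j => (hQ j).isSelfAdjoint.star_eq
  have hKs : ∀ j, star (K j) = -K j := fun j => by simp [hK, hQs, hA.star_eq]
  have hmono' : ∀ a b, a ≤ b → Q a * Q b = Q a := fun a b hab => by
    simpa [hQs] using congrArg star (hmono a b hab)
  have hstep' : ∀ a, Q a * A * Q (a + 1) = Q a * A := fun a => by
    simpa [hQs, hA.star_eq] using congrArg star (hstep a)
  have hup : ∀ a, Q (2 * a + 1) * K a = K a := fun a => by
    simp only [hK, mul_sub, hstep, ← mul_assoc, hmono (2 * a) (2 * a + 1) (Nat.le_succ _)]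
  have hup' : ∀ a, K a * Q (2 * a + 1) = K a := fun a => by
    simpa [hQs, hKs] using congrArg star (hup a)
  have hdown : ∀ b, Q (2 * b + 1) * K (b + 1) = 0 := fun b => by
    have h1 := hmono' (2 * b + 1) (2 * (b + 1)) (by lia)
    have h2 := hstep' (2 * b + 1)
    rw [show 2 * b + 1 + 1 = 2 * (b + 1) by lia] at h2
    simp only [hK, mul_sub, ← mul_assoc, h1, h2, sub_self]
  have horth : ∀ a b, a < b → K a * K b = 0 := fun a b hab => by
    obtain ⟨c, rfl⟩ : ∃ c, b = c + 1 := ⟨b - 1, by lia⟩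
    rw [← hup' a, ← hmono' (2 * a + 1) (2 * c + 1) (by lia)]
    simp only [mul_assoc, hdown, mul_zero]
  have hKnorm : ∀ a, ‖K a‖ ≤ 2 * ‖A‖ := fun a => by
    have hq := norm_le_one_of_isStarProjection (hQ (2 * a))
    calc ‖K a‖ ≤ ‖Q (2 * a)‖ * ‖A‖ + ‖A‖ * ‖Q (2 * a)‖ :=
          (norm_sub_le _ _).trans (add_le_add (norm_mul_le _ _) (norm_mul_le _ _))
      _ ≤ 1 * ‖A‖ + ‖A‖ * 1 := by gcongr
      _ = 2 * ‖A‖ := by ring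
  rw [Finset.sum_mul, Finset.mul_sum, ← Finset.sum_sub_distrib]
  change ‖∑ j ∈ Finset.range n, K j‖ ^ 2 ≤ _
  induction n with
  | zero => simp
  | succ n ih =>
    have hsK : star (∑ j ∈ Finset.range n, K j) * K n = 0 := by
      rw [star_sum, Finset.sum_mul]
      refine Finset.sum_eq_zero fun j hj => ?_
      rw [hKs, neg_mul, horth j n (Finset.mem_range.1 hj), neg_zero]
    have hKs' : star (K n) * ∑ j ∈ Finset.range n, K j = 0 := by
      simpa using congrArg star hsK
    rw [Finset.sum_range_succ, sq, ← CStarRing.norm_star_mul_self, star_add, add_mul, mul_add,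
      mul_add, hsK, hKs', add_zero, zero_add]
    refine (norm_add_le _ _).trans ?_
    rw [CStarRing.norm_star_mul_self, CStarRing.norm_star_mul_self, ← sq, ← sq]
    have := pow_le_pow_left₀ (norm_nonneg _) (hKnorm n) 2
    push_cast
    linarith

end CStarAlgebra

section HilbertSpace

open scoped InnerProductSpace

variable {ι : Type*}

theorem HilbertBasis.ext_inner (b : HilbertBasis ι ℂ H) {x y : H}
    (h : ∀ i, ⟪b i, x⟫_ℂ = ⟪b i, y⟫_ℂ) : x = y := by
  apply b.repr.injective
  ext i
  rw [b.repr_apply_apply, b.repr_apply_apply, h i]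

theorem HilbertBasis.ext_clm (b : HilbertBasis ι ℂ H) {f g : H →L[ℂ] H}
    (h : ∀ i, f (b i) = g (b i)) : f = g := by
  refine ContinuousLinearMap.ext_on (s := Set.range b) ?_ ?_
  · rw [Submodule.dense_iff_topologicalClosure_eq_top, b.dense_span]
  · rintro _ ⟨i, rfl⟩
    exact h i

theorem Orthonormal.exists_linearIsometry {E : Type*} [NormedAddCommGroup E] [InnerProductSpace ℂ E]
    (b : HilbertBasis ι ℂ E) {v : ι → H} (hv : Orthonormal ℂ v) :
    ∃ J : E →ₗᵢ[ℂ] H, ∀ i, J (b i) = v i := by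
  classical
  refine ⟨hv.orthogonalFamily.linearIsometry.comp b.repr.toLinearIsometry, fun i => ?_⟩
  simp [HilbertBasis.repr_self, OrthogonalFamily.linearIsometry_apply_single]

theorem LinearIsometry.star_mul_self_eq_one (J : H →ₗᵢ[ℂ] H) :
    star J.toContinuousLinearMap * J.toContinuousLinearMap = 1 := by
  ext x
  refine ext_inner_left ℂ fun y => ?_
  simp [ContinuousLinearMap.star_eq_adjoint, ContinuousLinearMap.adjoint_inner_right]

theorem HilbertBasis.exists_halfPair (b : HilbertBasis ι ℂ H) (c : HilbertBasis (ι ⊕ ι) ℂ H) :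
    ∃ S T : H →L[ℂ] H, IsHalfPair S T ∧ (∀ i, S (b i) = c (.inl i)) ∧
      ∀ i, T (b i) = c (.inr i) := by
  obtain ⟨S, hS⟩ := (c.orthonormal.comp Sum.inl Sum.inl_injective).exists_linearIsometry b
  obtain ⟨T, hT⟩ := (c.orthonormal.comp Sum.inr Sum.inr_injective).exists_linearIsometry b
  have hST : star S.toContinuousLinearMap * T.toContinuousLinearMap = 0 := by
    refine b.ext_clm fun j => b.ext_inner fun i => ?_
    simp only [mul_apply_eq_comp, ContinuousLinearMap.star_eq_adjoint,
      ContinuousLinearMap.adjoint_inner_right, zero_apply, inner_zero_right]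
    exact (congrArg₂ _ (hS i) (hT j)).trans (c.orthonormal.2 (by simp))
  have hTS : star T.toContinuousLinearMap * S.toContinuousLinearMap = 0 := by
    simpa using congrArg star hST
  refine ⟨S.toContinuousLinearMap, T.toContinuousLinearMap,
    ⟨S.star_mul_self_eq_one, T.star_mul_self_eq_one, hST, ?_⟩, hS, hT⟩
  refine c.ext_clm ?_
  rintro (i | i)
  · have := congrArg (fun f : H →L[ℂ] H => f (b i)) (show
      (S.toContinuousLinearMap * star S.toContinuousLinearMap +
        T.toContinuousLinearMap * star T.toContinuousLinearMap) * S.toContinuousLinearMap =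
      1 * S.toContinuousLinearMap by
        rw [add_mul, mul_assoc, mul_assoc, S.star_mul_self_eq_one, hTS, mul_zero, add_zero,
          mul_one, one_mul])
    rw [← Function.comp_apply (f := c), ← hS i]
    exact this
  · have := congrArg (fun f : H →L[ℂ] H => f (b i)) (show
      (S.toContinuousLinearMap * star S.toContinuousLinearMap +
        T.toContinuousLinearMap * star T.toContinuousLinearMap) * T.toContinuousLinearMap =
      1 * T.toContinuousLinearMap by
        rw [add_mul, mul_assoc, mul_assoc, T.star_mul_self_eq_one, hST, mul_zero, zero_add,
          mul_one, one_mul])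
    rw [← Function.comp_apply (f := c), ← hT i]
    exact this

theorem HilbertBasis.infinite_index (hH : ¬ FiniteDimensional ℂ H) (b : HilbertBasis ι ℂ H) :
    Infinite ι := by
  by_contra hι
  have : Fintype ι := @Fintype.ofFinite _ (not_infinite_iff_finite.1 hι)
  exact hH b.toOrthonormalBasis.toBasis.finiteDimensional_of_finite

def HilbertBasis.reindexEquiv {κ : Type*} (b : HilbertBasis ι ℂ H) (e : κ ≃ ι) :
    HilbertBasis κ ℂ H :=
  .mk (v := b ∘ e) (b.orthonormal.comp e e.injective)
    (by rw [e.surjective.range_comp, b.dense_span])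

theorem HilbertBasis.reindexEquiv_apply {κ : Type*} (b : HilbertBasis ι ℂ H) (e : κ ≃ ι) (j : κ) :
    b.reindexEquiv e j = b (e j) := by
  rw [reindexEquiv, HilbertBasis.coe_mk]; rfl

theorem exists_isHalfPair (hH : ¬ FiniteDimensional ℂ H) : ∃ V W : H →L[ℂ] H, IsHalfPair V W := by
  obtain ⟨w, b, -⟩ := exists_hilbertBasis ℂ H
  have := b.infinite_index hH
  obtain ⟨e⟩ : Nonempty (w ⊕ w ≃ w) := by
    rw [← Cardinal.eq, Cardinal.mk_sum, Cardinal.lift_id, Cardinal.add_eq_self (Cardinal.aleph0_le_mk w)]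
  obtain ⟨V, W, h, -⟩ := b.exists_halfPair (b.reindexEquiv e)
  exact ⟨V, W, h⟩

theorem Orthonormal.countable_index {E : Type*} [NormedAddCommGroup E] [InnerProductSpace ℂ E]
    [TopologicalSpace.SeparableSpace E] {v : ι → E} (hv : Orthonormal ℂ v) : Countable ι := by
  refine (Pairwise.countable_of_isOpen_disjoint (s := fun i => Metric.ball (v i) (1 / 2)) ?_
    (fun i => Metric.isOpen_ball) fun i => ⟨v i, Metric.mem_ball_self (by norm_num)⟩)
  intro i j hij
  refine Metric.ball_disjoint_ball ?_
  rw [dist_eq_norm]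
  have h := norm_sub_sq (𝕜 := ℂ) (v i) (v j)
  rw [hv.1, hv.1, hv.2 hij, map_zero] at h
  nlinarith [norm_nonneg (v i - v j)]

end HilbertSpace

variable {k : ℕ}

section Separable

open scoped InnerProductSpace
open TopologicalSpace

theorem exists_isHalfPair_extension [SeparableSpace H] {v v' : ℕ → H}
    (hv : Orthonormal ℂ (Sum.elim v v')) :
    ∃ (b : HilbertBasis ℕ ℂ H) (S T : H →L[ℂ] H), IsHalfPair S T ∧ ∀ i, S (b i) = v i := by
  obtain ⟨w, b, hw, hb⟩ := hv.toSubtypeRange.exists_hilbertBasis_extension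
  have hbo := b.orthonormal
  have : Countable w := hbo.countable_index
  have hvinj : Function.Injective (Sum.elim v v') := hv.linearIndependent.injective
  have hvw : ∀ j, Sum.elim v v' j ∈ w := fun j => hw ⟨j, rfl⟩
  have : Infinite w := .of_injective (fun j => ⟨_, hvw j⟩) fun i j hij => hvinj (by simpa using hij)
  have : Infinite {x : w // (x : H) ∉ Set.range v} := by
    refine .of_injective (fun j : ℕ => ⟨⟨v' j, hvw (.inr j)⟩, ?_⟩) fun i j hij => ?_
    · rintro ⟨i, hi⟩
      exact absurd (hvinj (a₁ := .inl i) (a₂ := .inr j) hi) (by simp)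
    · simpa using hvinj (a₁ := .inr i) (a₂ := .inr j) (congrArg (fun x => (x.1 : H)) hij)
  obtain ⟨e⟩ : Nonempty (ℕ ≃ {x : w // (x : H) ∉ Set.range v}) := nonempty_equiv_of_countable
  obtain ⟨e'⟩ : Nonempty (ℕ ≃ w) := nonempty_equiv_of_countable
  let f : ℕ ⊕ ℕ → w := Sum.elim (fun i => ⟨v i, hvw (.inl i)⟩) fun i => (e i).1
  have hf : Function.Bijective f := by
    refine ⟨Function.Injective.sumElim (fun i j hij => ?_) (fun i j hij => ?_) fun i j hij => ?_,
      fun x => ?_⟩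
    · simpa using hvinj (a₁ := .inl i) (a₂ := .inl j) (congrArg Subtype.val hij)
    · exact e.injective (Subtype.ext hij)
    · exact (e j).2 ⟨i, congrArg Subtype.val hij⟩
    · by_cases hx : (x : H) ∈ Set.range v
      · obtain ⟨i, hi⟩ := hx
        exact ⟨.inl i, Subtype.ext hi⟩
      · exact ⟨.inr (e.symm ⟨x, hx⟩), by simp [f]⟩
  obtain ⟨S, T, hST, hS, -⟩ :=
    (b.reindexEquiv e').exists_halfPair (b.reindexEquiv (Equiv.ofBijective f hf))
  refine ⟨_, S, T, hST, fun i => (hS i).trans ?_⟩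
  rw [HilbertBasis.reindexEquiv_apply, hb]
  rfl

theorem exists_unit_sequence (hH : ¬ FiniteDimensional ℂ H) {𝒯 : Set (H →L[ℂ] H)} (h𝒯 : 𝒯.Finite) :
    ∃ z : ℕ → H, (∀ n, ‖z n‖ = 1) ∧ Pairwise fun m n => ∀ T ∈ 𝒯, ⟪T (z m), z n⟫_ℂ = 0 := by
  let r : H → H → Prop := fun x y => ∀ T ∈ 𝒯, ⟪T x, y⟫_ℂ = 0 ∧ ⟪T y, x⟫_ℂ = 0
  have : Std.Symm r := ⟨fun x y h T hT => (h T hT).symm⟩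
  obtain ⟨z, hz, hr⟩ := exists_seq_of_forall_finset_exists' (fun z : H => ‖z‖ = 1) r fun s _ => by
    have hfin : (⋃ x ∈ s, ⋃ T ∈ 𝒯, {T x, star T x}).Finite :=
      s.finite_toSet.biUnion fun x _ => h𝒯.biUnion fun T _ => Set.toFinite _
    let U := Submodule.span ℂ (⋃ x ∈ s, ⋃ T ∈ 𝒯, {T x, star T x})
    have : FiniteDimensional ℂ U := FiniteDimensional.span_of_finite ℂ hfin
    obtain ⟨y, hy, hy0⟩ := (Submodule.ne_bot_iff Uᗮ).1 fun h => hH <| by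
      rw [Submodule.orthogonal_eq_bot_iff] at h
      have : FiniteDimensional ℂ (⊤ : Submodule ℂ H) := h ▸ ‹FiniteDimensional ℂ U›
      exact Submodule.topEquiv.finiteDimensional
    have hmem : ∀ u ∈ ⋃ x ∈ s, ⋃ T ∈ 𝒯, {T x, star T x}, ⟪u, y⟫_ℂ = 0 := fun u hu =>
      (Submodule.mem_orthogonal _ _).1 hy u (Submodule.subset_span hu)
    refine ⟨((‖y‖⁻¹ : ℝ) : ℂ) • y, by simp [norm_smul, hy0], fun x hx T hT => ?_⟩
    have h1 := hmem (T x) (by simp only [Set.mem_iUnion]; exact ⟨x, hx, T, hT, .inl rfl⟩)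
    have h2 := hmem (star T x) (by simp only [Set.mem_iUnion]; exact ⟨x, hx, T, hT, .inr rfl⟩)
    rw [ContinuousLinearMap.star_eq_adjoint, ContinuousLinearMap.adjoint_inner_left] at h2
    have h3 : ⟪T y, x⟫_ℂ = 0 := by rw [← inner_conj_symm, h2, map_zero]
    simp [inner_smul_left, inner_smul_right, h1, h3]
  exact ⟨z, hz, fun m n hmn T hT => (hr hmn T hT).1⟩

/-- Products of at most `j` of the operators `A i`. -/
def words (A : Fin k → H →L[ℂ] H) : ℕ → Set (H →L[ℂ] H)
  | 0 => {1}
  | j + 1 => words A j ∪ ⋃ i, (A i * ·) '' words A j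

theorem words_finite (A : Fin k → H →L[ℂ] H) (j : ℕ) : (words A j).Finite := by
  induction j with
  | zero => exact Set.finite_singleton 1
  | succ j ih => exact ih.union (Set.finite_iUnion fun i => ih.image _)

theorem words_mono (A : Fin k → H →L[ℂ] H) : Monotone (words A) :=
  monotone_nat_of_le_succ fun _ => Set.subset_union_left

theorem one_mem_words (A : Fin k → H →L[ℂ] H) (j : ℕ) : (1 : H →L[ℂ] H) ∈ words A j :=
  words_mono A j.zero_le rfl

theorem mul_mem_words {A : Fin k → H →L[ℂ] H} {j : ℕ} {T : H →L[ℂ] H} (hT : T ∈ words A j)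
    (i : Fin k) : A i * T ∈ words A (j + 1) :=
  .inr (Set.mem_iUnion.2 ⟨i, T, hT, rfl⟩)

/-- The closed linear span of a set of vectors. -/
def closedSpan (s : Set H) : Submodule ℂ H := (Submodule.span ℂ s).topologicalClosure

theorem isClosed_closedSpan (s : Set H) : IsClosed (closedSpan s : Set H) :=
  Submodule.isClosed_topologicalClosure _

instance (s : Set H) : CompleteSpace (closedSpan s) := (isClosed_closedSpan s).completeSpace_coe

theorem subset_closedSpan {s : Set H} {x : H} (hx : x ∈ s) : x ∈ closedSpan s :=
  Submodule.le_topologicalClosure _ (Submodule.subset_span hx)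

theorem map_mem_of_mem_closedSpan {s : Set H} {N : Submodule ℂ H} (hN : IsClosed (N : Set H))
    (T : H →L[ℂ] H) (h : ∀ x ∈ s, T x ∈ N) {x : H} (hx : x ∈ closedSpan s) : T x ∈ N := by
  have : closedSpan s ≤ N.comap (T : H →ₗ[ℂ] H) :=
    Submodule.topologicalClosure_minimal _ (Submodule.span_le.2 h) (hN.preimage T.continuous)
  exact this hx

theorem hasAlmostCommutingSplitting (hH : ¬ FiniteDimensional ℂ H) [SeparableSpace H]
    {A : Fin k → H →L[ℂ] H} (hA : ∀ i, IsSelfAdjoint (A i)) : HasAlmostCommutingSplitting A := by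
  intro η hη
  obtain ⟨n, hn⟩ := exists_nat_gt ((2 * ∑ i, ‖A i‖) ^ 2 / η ^ 2)
  have hn0 : (0 : ℝ) < n := lt_of_le_of_lt (by positivity) hn
  rw [div_lt_iff₀ (by positivity)] at hn
  obtain ⟨z, hz, hzT⟩ := exists_unit_sequence hH (words_finite A (2 * n))
  have hzo : ∀ i j, i ≠ j → ⟪z i, z j⟫_ℂ = 0 := fun i j hij => by
    simpa using hzT hij 1 (one_mem_words A _)
  let X : ℕ → Submodule ℂ H := fun j =>
    closedSpan (⋃ T ∈ words A j, Set.range fun m => T (z (2 * m)))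
  have hXcl : ∀ j, IsClosed (X j : Set H) := fun j => isClosed_closedSpan _
  have hXmem : ∀ {j T}, T ∈ words A j → ∀ m, T (z (2 * m)) ∈ X j := fun {j T} hT m =>
    subset_closedSpan (by simp only [Set.mem_iUnion]; exact ⟨T, hT, m, rfl⟩)
  have hXmap : ∀ {j : ℕ} {N : Submodule ℂ H} (_ : IsClosed (N : Set H)) (B : H →L[ℂ] H),
      (∀ T ∈ words A j, ∀ m, B (T (z (2 * m))) ∈ N) → ∀ x ∈ X j, B x ∈ N := by
    intro j N hN B h x hx
    refine map_mem_of_mem_closedSpan hN B (fun x hx => ?_) hx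
    simp only [Set.mem_iUnion] at hx
    obtain ⟨T, hT, m, rfl⟩ := hx
    exact h T hT m
  have hXmono : ∀ a b, a ≤ b → X a ≤ X b := fun a b hab x hx => by
    simpa using hXmap (hXcl b) 1 (fun T hT m => hXmem (words_mono A hab hT) m) x hx
  have hXstep : ∀ i j, ∀ x ∈ X j, A i x ∈ X (j + 1) := fun i j =>
    hXmap (hXcl _) (A i) fun T hT m => hXmem (mul_mem_words hT i) m
  have hXy : ∀ j ≤ 2 * n, ∀ m, z (2 * m + 1) ∈ (X j)ᗮ := fun j hj m => by
    refine (Submodule.mem_orthogonal _ _).2 fun x hx => ?_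
    have := hXmap (N := (ℂ ∙ z (2 * m + 1))ᗮ) (Submodule.isClosed_orthogonal _) 1
      (fun T hT l => Submodule.mem_orthogonal_singleton_iff_inner_left.2
        (hzT (by lia) T (words_mono A hj hT))) x hx
    exact Submodule.mem_orthogonal_singleton_iff_inner_left.1 this
  let Q : ℕ → H →L[ℂ] H := fun j => (X j).starProjection
  have hQ : ∀ j x, x ∈ X j → Q j x = x := fun j x hx =>
    Submodule.starProjection_eq_self_iff.2 hx
  have hQmem : ∀ j x, Q j x ∈ X j := fun j x => Submodule.starProjection_apply_mem _ x
  have hbound := fun i => norm_sq_commutator_sum_le (Q := Q) (A := A i)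
    (fun j => isStarProjection_starProjection)
    (fun a b hab => ContinuousLinearMap.ext fun x => hQ b _ (hXmono a b hab (hQmem a x))) (hA i)
    (fun a => ContinuousLinearMap.ext fun x => hQ _ _ (hXstep i a _ (hQmem a x))) n
  have hsum : ∀ x, (∑ j ∈ Finset.range n, Q (2 * j)) x = ∑ j ∈ Finset.range n, Q (2 * j) x :=
    fun x => by simp
  have hnn : ((n : ℝ)⁻¹ * n) = 1 := inv_mul_cancel₀ hn0.ne'
  refine ⟨(n : ℝ)⁻¹ • ∑ j ∈ Finset.range n, Q (2 * j), .real_smul _ ?_, fun i => ?_, ?_, ?_⟩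
  · rw [IsSelfAdjoint, star_sum]
    exact Finset.sum_congr rfl fun j _ =>
      (isStarProjection_starProjection (U := X (2 * j))).isSelfAdjoint.star_eq
  · rw [smul_mul_assoc, mul_smul_comm, ← smul_sub, norm_smul, norm_inv, Real.norm_natCast,
      inv_mul_le_iff₀ hn0]
    refine abs_le_of_sq_le_sq' ?_ (by positivity) |>.2
    have h1 : ‖A i‖ ≤ ∑ i, ‖A i‖ :=
      Finset.single_le_sum (fun j _ => norm_nonneg (A j)) (Finset.mem_univ i)
    calc _ ≤ n * (2 * ‖A i‖) ^ 2 := hbound i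
      _ ≤ n * (2 * ∑ i, ‖A i‖) ^ 2 := by gcongr
      _ ≤ n * (n * η ^ 2) := by gcongr
      _ = (n * η) ^ 2 := by ring
  · obtain ⟨b, S, T, hST, hS⟩ := exists_isHalfPair_extension
      (v := fun m => z (2 * m + 1)) (v' := fun m => z (2 * m))
      ⟨by rintro (i | i) <;> exact hz _, by rintro (i | i) (j | j) hij <;> exact hzo _ _ (by grind)⟩
    refine ⟨S, T, hST, b.ext_clm fun i => ?_⟩
    have hz0 : ∀ j ∈ Finset.range n, Q (2 * j) (z (2 * i + 1)) = 0 := fun j hj =>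
      (Submodule.starProjection_apply_eq_zero_iff _).2
        (hXy _ (by have := Finset.mem_range.1 hj; lia) i)
    change (n : ℝ)⁻¹ • (∑ j ∈ Finset.range n, Q (2 * j)) (S (b i)) = 0
    rw [hS, hsum, Finset.sum_eq_zero hz0, smul_zero]
  · obtain ⟨b, S, T, hST, hS⟩ := exists_isHalfPair_extension
      (v := fun m => z (2 * m)) (v' := fun m => z (2 * m + 1))
      ⟨by rintro (i | i) <;> exact hz _, by rintro (i | i) (j | j) hij <;> exact hzo _ _ (by grind)⟩
    refine ⟨S, T, hST, b.ext_clm fun i => ?_⟩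
    have hz1 : ∀ j ∈ Finset.range n, Q (2 * j) (z (2 * i)) = z (2 * i) := fun j _ =>
      hQ _ _ (by simpa using hXmem (one_mem_words A (2 * j)) i)
    change (n : ℝ)⁻¹ • (∑ j ∈ Finset.range n, Q (2 * j)) (S (b i)) = S (b i)
    rw [hS, hsum, Finset.sum_congr rfl hz1, Finset.sum_const, Finset.card_range,
      ← Nat.cast_smul_eq_nsmul ℝ, smul_smul, hnn, one_smul]

end Separable

section NonSeparable

open scoped InnerProductSpace
open TopologicalSpace

theorem separableSpace_closedSpan {s : Set H} (hs : s.Countable) : SeparableSpace (closedSpan s) :=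
  (hs.isSeparable.span (R := ℂ)).closure.separableSpace

theorem separableSpace_of_finiteDimensional_orthogonal (N : Submodule ℂ H) [CompleteSpace N]
    [SeparableSpace N] [FiniteDimensional ℂ Nᗮ] : SeparableSpace H := by
  have : ProperSpace Nᗮ := FiniteDimensional.proper ℂ _
  refine Function.Surjective.denseRange (f := fun x : N × Nᗮ => (x.1 : H) + x.2) ?_
    |>.separableSpace (by fun_prop)
  intro x
  exact ⟨(N.orthogonalProjectionOnto x, Nᗮ.orthogonalProjectionOnto x),
    N.starProjection_add_starProjection_orthogonal x⟩

theorem exists_linearIsometry_of_separableSpace {E : Type*} [NormedAddCommGroup E]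
    [InnerProductSpace ℂ E] [CompleteSpace E] [SeparableSpace E] (hH : ¬ FiniteDimensional ℂ H) :
    Nonempty (E →ₗᵢ[ℂ] H) := by
  obtain ⟨w, b, -⟩ := exists_hilbertBasis ℂ E
  obtain ⟨w', b', -⟩ := exists_hilbertBasis ℂ H
  have := b'.infinite_index hH
  have : Countable w := b.orthonormal.countable_index
  obtain ⟨e, he⟩ := exists_injective_nat w
  obtain ⟨J, -⟩ := (b'.orthonormal.comp _
    ((Infinite.natEmbedding w').injective.comp he)).exists_linearIsometry b
  exact ⟨J⟩

theorem exists_reducing_isometry (hsep : ¬ SeparableSpace H) (V : H →L[ℂ] H)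
    {A : Fin k → H →L[ℂ] H} (hA : ∀ i, IsSelfAdjoint (A i)) (ξ : H) :
    ∃ p w : H →L[ℂ] H, IsStarProjection p ∧ (∀ i, Commute p (A i)) ∧ w * p = w ∧
      star w * w = p ∧ p * w = 0 ∧ star (V * p) * w = 0 ∧ p ξ = ξ := by
  set D : Set H := ⋃ j, ⋃ T ∈ words A j, {T ξ} with hD
  have hDc : D.Countable := Set.countable_iUnion fun j =>
    (words_finite A j).countable.biUnion fun T _ => Set.countable_singleton _
  have hDmem : ∀ {j T}, T ∈ words A j → T ξ ∈ D := fun {j T} hT => by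
    simp only [hD, Set.mem_iUnion]; exact ⟨j, T, hT, rfl⟩
  set M := closedSpan D
  set N := closedSpan (D ∪ V '' D)
  have : SeparableSpace M := separableSpace_closedSpan hDc
  have : SeparableSpace N := separableSpace_closedSpan (hDc.union (hDc.image V))
  have hNinf : ¬ FiniteDimensional ℂ Nᗮ := fun h =>
    hsep (separableSpace_of_finiteDimensional_orthogonal N)
  obtain ⟨J⟩ := exists_linearIsometry_of_separableSpace (E := M) hNinf
  have hAM : ∀ i, ∀ x ∈ M, A i x ∈ M := fun i x hx => by
    refine map_mem_of_mem_closedSpan (isClosed_closedSpan _) (A i) (fun x hx => ?_) hx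
    simp only [hD, Set.mem_iUnion] at hx
    obtain ⟨j, T, hT, rfl⟩ := hx
    exact subset_closedSpan (hDmem (mul_mem_words hT i))
  have hMN : ∀ x ∈ M, x ∈ N := fun x hx => by
    simpa using map_mem_of_mem_closedSpan (isClosed_closedSpan _) (1 : H →L[ℂ] H)
      (fun x hx => subset_closedSpan (.inl hx)) hx
  have hVMN : ∀ x ∈ M, V x ∈ N := fun x hx =>
    map_mem_of_mem_closedSpan (isClosed_closedSpan _) V
      (fun x hx => subset_closedSpan (.inr ⟨x, hx, rfl⟩)) hx
  set p := M.starProjection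
  have hp : IsStarProjection p := isStarProjection_starProjection
  have hpmem : ∀ x, p x ∈ M := fun x => Submodule.starProjection_apply_mem _ x
  have hpeq : ∀ x ∈ M, p x = x := fun x hx => Submodule.starProjection_eq_self_iff.2 hx
  let w : H →L[ℂ] H :=
    Nᗮ.subtypeL ∘L J.toContinuousLinearMap ∘L M.orthogonalProjectionOnto
  have hw : ∀ x, w x ∈ Nᗮ := fun x => (J (M.orthogonalProjectionOnto x)).2
  have hwp : w * p = w := by
    ext x
    change ((J (M.orthogonalProjectionOnto (p x)) : Nᗮ) : H) = J (M.orthogonalProjectionOnto x)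
    congr 2
    exact Subtype.ext (hpeq _ (hpmem x))
  have hinner : ∀ x y, ⟪w x, w y⟫_ℂ = ⟪p x, p y⟫_ℂ := fun x y =>
    J.inner_map_map (M.orthogonalProjectionOnto x) (M.orthogonalProjectionOnto y)
  refine ⟨p, w, hp, fun i => ?_, hwp, ?_, ?_, ?_, hpeq _ ?_⟩
  · have h1 : p * (A i * p) = A i * p := ContinuousLinearMap.ext fun x =>
      hpeq _ (hAM i _ (hpmem x))
    have h2 := congrArg star h1
    simp only [star_mul, hp.isSelfAdjoint.star_eq, (hA i).star_eq] at h2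
    rw [Commute, SemiconjBy, ← h2, mul_assoc, h1]
  · refine ContinuousLinearMap.ext fun y => ext_inner_left ℂ fun x => ?_
    rw [mul_apply_eq_comp, ContinuousLinearMap.star_eq_adjoint,
      ContinuousLinearMap.adjoint_inner_right, hinner, Submodule.inner_starProjection_left_eq_right,
      hpeq _ (hpmem y)]
  · refine ContinuousLinearMap.ext fun y => ?_
    exact (Submodule.starProjection_apply_eq_zero_iff _).2 <| (Submodule.mem_orthogonal _ _).2
      fun u hu => (Submodule.mem_orthogonal _ _).1 (hw y) u (hMN u hu)
  · refine ContinuousLinearMap.ext fun y => ext_inner_left ℂ fun x => ?_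
    rw [mul_apply_eq_comp, ContinuousLinearMap.star_eq_adjoint,
      ContinuousLinearMap.adjoint_inner_right, zero_apply, inner_zero_right]
    exact (Submodule.mem_orthogonal _ _).1 (hw y) _ (hVMN _ (hpmem x))
  · simpa using subset_closedSpan (hDmem (one_mem_words A 0))

theorem IsRegularSublinear.eq_compression_of_infiniteDimensional (hH : ¬ FiniteDimensional ℂ H)
    {F : (Fin k → H →L[ℂ] H) → H →L[ℂ] H} (hF : IsRegularSublinear F) {V W : H →L[ℂ] H}
    (hVW : IsHalfPair V W) {A : Fin k → H →L[ℂ] H} (hA : ∀ i, IsStrictlyPositive (A i)) :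
    F A = compression F V A := by
  have hAsa : ∀ i, IsSelfAdjoint (A i) := fun i => (hA i).isSelfAdjoint
  by_cases hsep : SeparableSpace H
  · exact hF.eq_compression hVW hA (hasAlmostCommutingSplitting hH hAsa)
  refine ContinuousLinearMap.coe_injective ((ext_inner_map _ _).1 fun ξ => ?_)
  obtain ⟨p, w, hp, hcomm, hwp, hw, hpw, hVw, hξ⟩ := exists_reducing_isometry hsep V hAsa ξ
  have h := hF.compress_eq_compress_compression hVW.left_isometry hp hA hcomm hwp hw hpw hVw
  have key : ∀ G : H →L[ℂ] H, ⟪G ξ, ξ⟫_ℂ = ⟪(p * G * p) ξ, ξ⟫_ℂ := fun G => by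
    have hadj := ContinuousLinearMap.adjoint_inner_left p ξ (G ξ)
    rw [← ContinuousLinearMap.star_eq_adjoint, hp.isSelfAdjoint.star_eq, hξ] at hadj
    rw [mul_apply_eq_comp, mul_apply_eq_comp, hξ, hadj]
  simp only [ContinuousLinearMap.coe_coe]
  rw [key, h, ← key]

end NonSeparable

theorem IsRegularPD.isRegularSublinear {F : (Fin k → H →L[ℂ] H) → H →L[ℂ] H} (hreg : IsRegularPD F)
    (hsa : ∀ A : Fin k → (H →L[ℂ] H), (∀ i, IsPosDefInv (A i)) → IsSelfAdjoint (F A))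
    (hconv : ∀ A B : Fin k → (H →L[ℂ] H),
      (∀ i, IsPosDefInv (A i)) → (∀ i, IsPosDefInv (B i)) →
      ∀ t : ℝ, 0 ≤ t → t ≤ 1 →
        F (fun i => t • A i + (1 - t) • B i) ≤ t • F A + (1 - t) • F B)
    (hhom : ∀ t : ℝ, 0 < t → ∀ A : Fin k → (H →L[ℂ] H), (∀ i, IsPosDefInv (A i)) →
      F (fun i => t • A i) = t • F A) : IsRegularSublinear F where
  isSelfAdjoint := hsa
  smul := hhom
  add_le A B hA hB := by
    have hsmul : ∀ {X : Fin k → H →L[ℂ] H}, (∀ i, IsStrictlyPositive (X i)) →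
        ∀ i, IsPosDefInv ((2 : ℝ) • X i) := fun hX i =>
      isStrictlyPositive_smul_tuple hX two_pos i
    have h := hconv (fun i => (2 : ℝ) • A i) (fun i => (2 : ℝ) • B i) (hsmul hA) (hsmul hB) 2⁻¹
      (by norm_num) (by norm_num)
    rw [hhom 2 two_pos A hA, hhom 2 two_pos B hB] at h
    norm_num [smul_smul] at h
    exact h
  unitary_conj u hu A hA := by
    have h := hreg.1 (star u) (Unitary.star_mem hu) A hA
    rw [star_star] at h
    exact h
  corner_add p q hp hq hpq x y hx hy := by
    have hpx : ∀ i, p * x i * p = x i := fun i => (hx i).2.1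
    have hqy : ∀ i, q * y i * q = y i := fun i => (hy i).2.1
    have h := hreg.2 p q hp.isSelfAdjoint hp.isIdempotentElem hq.isSelfAdjoint hq.isIdempotentElem
      hpq x y (fun i => (hpx i).symm ▸ hx i) (fun i => (hqy i).symm ▸ hy i)
    simp only [hpx, hqy] at h
    exact h

/-- **Transformer equality.** A convex, positively homogeneous regular mapping of `k`-tuples
of positive definite invertible operators into self-adjoint operators satisfies
`F(C*A₁C,…,C*AₖC) = C* F(A₁,…,Aₖ) C` for every invertible operator `C`. -/
theorem transformer_equality
    (hH : ¬ FiniteDimensional ℂ H) {k : ℕ}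
    (F : (Fin k → (H →L[ℂ] H)) → (H →L[ℂ] H))
    (hreg : IsRegularPD F)
    (hsa : ∀ A : Fin k → (H →L[ℂ] H), (∀ i, IsPosDefInv (A i)) → IsSelfAdjoint (F A))
    (hconv : ∀ A B : Fin k → (H →L[ℂ] H),
      (∀ i, IsPosDefInv (A i)) → (∀ i, IsPosDefInv (B i)) →
      ∀ t : ℝ, 0 ≤ t → t ≤ 1 →
        F (fun i => t • A i + (1 - t) • B i) ≤ t • F A + (1 - t) • F B)
    (hhom : ∀ t : ℝ, 0 < t → ∀ A : Fin k → (H →L[ℂ] H), (∀ i, IsPosDefInv (A i)) →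
      F (fun i => t • A i) = t • F A)
    (C : H →L[ℂ] H) (hC : IsUnit C)
    (A : Fin k → (H →L[ℂ] H)) (hA : ∀ i, IsPosDefInv (A i)) :
    F (fun i => star C * A i * C) = star C * F A * C := by
  have hF := hreg.isRegularSublinear hsa hconv hhom
  obtain ⟨V, W, hVW⟩ := exists_isHalfPair hH
  have hCA : ∀ i, IsStrictlyPositive (conjTuple (star C) A i) := fun i => by
    rw [conjTuple_apply, star_star]
    exact IsStrictlyPositive.conj_of_isUnit (hA i) hC
  have hconj := hF.compression_conj hVW hA hC
  rw [← hF.eq_compression_of_infiniteDimensional hH hVW hA,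
    ← hF.eq_compression_of_infiniteDimensional hH hVW hCA] at hconj
  rw [← hconj]
  congr 1
  ext1 i
  rw [conjTuple_apply, star_star]
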